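/- Let (X_t)_{t∈ℤ} be a strictly stationary real-valued process that is S-mixing with coefficients γ_m = δ_m = O(m^{−A}) for some A > 4. Fix 0 < p_1 < ... < p_k < 1 and let ξ_i denote the p_i-th quantile of the marginal distribution F of X_0. Suppose F has a density f that is positive and continuous in a neighbourhood of each ξ_i and f is uniformly bounded by some constant B. Let ξ̂_n = (ξ̂_{p_1,n},...,ξ̂_{p_k,n})' be the vector of empirical quantiles from X_1,...,X_n. Then √n(ξ̂_n − ξ) converges in distribution to a centered k-dimensional Gaussian distribution with covariance matrix Σ whose (i,j) entry is σ_{ij} = [Σ_{h∈ℤ} (P(X_0 ≤ ξ_i, X_h ≤ ξ_j) − p_i p_j)] / (f(ξ_i) f(ξ_j)), the series being summable. -/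

import Mathlib

open MeasureTheory ProbabilityTheory Filter Topology

/-- The `p`-th quantile of a distribution function `F`: `inf {x | F x ≥ p}`. -/
noncomputable def quantileOf (F : ℝ → ℝ) (p : ℝ) : ℝ := sInf {x | p ≤ F x}

/-- Empirical `p`-th quantile computed from the observations `X 1, …, X n` of a
process indexed by `ℤ`. -/
noncomputable def empQuantileZ {Ω : Type*} (X : ℤ → Ω → ℝ) (n : ℕ) (p : ℝ) (ω : Ω) : ℝ :=
  quantileOf (fun x => (n : ℝ)⁻¹ *
    ∑ t ∈ Finset.range n, if X (t + 1) ω ≤ x then (1 : ℝ) else 0) p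

/-- A process `(X t)_{t ∈ ℤ}` is S-mixing (Berkes–Hörmann–Schauer) with coefficients
`γ, δ` if each `X t` can be approximated by an `m`-dependent-type array `Y t m` with
`P(|X t − Y t m| ≥ γ m) ≤ δ m`, `γ m → 0`, `δ m → 0`, and families
`{Y t (m k) : t ∈ I k}` over intervals `I k` of integers are independent as soon as the
separation between `I k` and `I l` exceeds `m k + m l`. -/
def SMixing {Ω : Type*} [MeasurableSpace Ω] (P : Measure Ω) (X : ℤ → Ω → ℝ)
    (γ δ : ℕ → ℝ) : Prop :=
  Tendsto γ atTop (𝓝 0) ∧ Tendsto δ atTop (𝓝 0) ∧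
  ∃ Y : ℤ → ℕ → Ω → ℝ,
    (∀ t m, Measurable (Y t m)) ∧
    (∀ t m, (P {ω | γ m ≤ |X t ω - Y t m ω|}).toReal ≤ δ m) ∧
    (∀ (r : ℕ) (a b : Fin r → ℤ) (m : Fin r → ℕ),
      (∀ i j : Fin r, i ≠ j →
        ∀ s ∈ Set.Icc (a i) (b i), ∀ t ∈ Set.Icc (a j) (b j),
          ((m i : ℤ) + (m j : ℤ) < |s - t|)) →
      iIndep (fun i : Fin r =>
        ⨆ t ∈ Set.Icc (a i) (b i),
          MeasurableSpace.comap (Y t (m i)) (inferInstance : MeasurableSpace ℝ)) P)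

/-- A `ℤ`-indexed real process is strictly stationary if all finite-dimensional
distributions are shift invariant. -/
def StrictlyStationary {Ω : Type*} [MeasurableSpace Ω] (P : Measure Ω)
    (X : ℤ → Ω → ℝ) : Prop :=
  ∀ (r : ℕ) (t : Fin r → ℤ) (s : ℤ),
    Measure.map (fun ω (i : Fin r) => X (t i + s) ω) P =
      Measure.map (fun ω (i : Fin r) => X (t i) ω) P


/-- Nice function: bounded, measurable, well approximated along `Y`. -/
def NiceFn {Ω : Type*} [MeasurableSpace Ω] (P : Measure Ω) (X : ℤ → Ω → ℝ)
    (Y : ℤ → ℕ → Ω → ℝ) (ψ : ℕ → ℝ) (M : ℝ) (G : ℝ → ℝ) : Prop :=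
  Measurable G ∧ (∀ x, |G x| ≤ M) ∧ ∀ t m, ∫ ω, |G (X t ω) - G (Y t m ω)| ∂P ≤ M * ψ m

/-- The independence clause of S-mixing. -/
def IndClause {Ω : Type*} [MeasurableSpace Ω] (P : Measure Ω) (Y : ℤ → ℕ → Ω → ℝ) : Prop :=
    (∀ (r : ℕ) (a b : Fin r → ℤ) (m : Fin r → ℕ),
      (∀ i j : Fin r, i ≠ j →
        ∀ s ∈ Set.Icc (a i) (b i), ∀ t ∈ Set.Icc (a j) (b j),
          ((m i : ℤ) + (m j : ℤ) < |s - t|)) →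
      iIndep (fun i : Fin r =>
        ⨆ t ∈ Set.Icc (a i) (b i),
          MeasurableSpace.comap (Y t (m i)) (inferInstance : MeasurableSpace ℝ)) P)

section basics
set_option linter.unusedSectionVars false
variable {Ω : Type*} [MeasurableSpace Ω] {P : Measure Ω} [IsProbabilityMeasure P]

lemma bdd_integrable {f : Ω → ℝ} (hf : Measurable f) {C : ℝ} (h : ∀ ω, |f ω| ≤ C) :
    Integrable f P :=
  Integrable.of_bound hf.aestronglyMeasurable C (ae_of_all _ fun ω => by simpa using h ω)

lemma stat_integral {X : ℤ → Ω → ℝ} (hmeas : ∀ t, Measurable (X t))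
    (hstat : StrictlyStationary P X) {E : Type*} [NormedAddCommGroup E] [NormedSpace ℝ E]
    [MeasurableSpace E] [BorelSpace E] [SecondCountableTopology E]
    (r : ℕ) (t : Fin r → ℤ) (s : ℤ) (Φ : (Fin r → ℝ) → E) (hΦ : Measurable Φ) :
    ∫ ω, Φ (fun i => X (t i + s) ω) ∂P = ∫ ω, Φ (fun i => X (t i) ω) ∂P := by
  have h := hstat r t s
  rw [← integral_map (φ := fun ω (i : Fin r) => X (t i + s) ω) (f := Φ)
      (measurable_pi_lambda _ fun i => hmeas _).aemeasurable
      hΦ.aestronglyMeasurable, h,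
    integral_map (measurable_pi_lambda _ fun i => hmeas _).aemeasurable
      hΦ.aestronglyMeasurable]

lemma stat_one {X : ℤ → Ω → ℝ} (hmeas : ∀ t, Measurable (X t))
    (hstat : StrictlyStationary P X) {G : ℝ → ℝ} (hG : Measurable G) (t : ℤ) :
    ∫ ω, G (X t ω) ∂P = ∫ ω, G (X 0 ω) ∂P := by
  have := stat_integral hmeas hstat 1 (fun _ => 0) t (fun x => G (x 0)) (by fun_prop)
  simpa using this

lemma stat_two {X : ℤ → Ω → ℝ} (hmeas : ∀ t, Measurable (X t))
    (hstat : StrictlyStationary P X) {G H : ℝ → ℝ} (hG : Measurable G) (hH : Measurable H)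
    (s t : ℤ) :
    ∫ ω, G (X s ω) * H (X t ω) ∂P = ∫ ω, G (X 0 ω) * H (X (t - s) ω) ∂P := by
  have := stat_integral hmeas hstat 2 ![0, t - s] s (fun x => G (x 0) * H (x 1)) (by fun_prop)
  simpa using this

lemma ind_pair {Y : ℤ → ℕ → Ω → ℝ} (hind : IndClause P Y)
    {s t : ℤ} {m : ℕ} (h : 2 * (m : ℤ) < |s - t|) : IndepFun (Y s m) (Y t m) P := by
  have := hind 2 ![s, t] ![s, t] (fun _ => m) (by
    intro i j hij a ha b hb
    fin_cases i <;> fin_cases j <;> simp at hij ha hb ⊢ <;> subst ha <;> subst hb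
    · linarith
    · rw [abs_sub_comm]; linarith)
  have h2 := this.indep (i := 0) (j := 1) (by decide)
  simpa [IndepFun_iff_Indep] using h2

lemma cov_bound {X : ℤ → Ω → ℝ} (hmeas : ∀ t, Measurable (X t)) {Y : ℤ → ℕ → Ω → ℝ}
    (hY : ∀ t m, Measurable (Y t m)) (hind : IndClause P Y) {ψ : ℕ → ℝ}
    {M : ℝ} {G H : ℝ → ℝ} (hG : NiceFn P X Y ψ M G) (hH : NiceFn P X Y ψ M H)
    {s t : ℤ} {m : ℕ} (h : 2 * (m : ℤ) < |s - t|) :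
    |∫ ω, G (X s ω) * H (X t ω) ∂P - (∫ ω, G (X s ω) ∂P) * ∫ ω, H (X t ω) ∂P|
      ≤ 4 * M ^ 2 * ψ m := by
  obtain ⟨hGm, hGb, hGa⟩ := hG
  obtain ⟨hHm, hHb, hHa⟩ := hH
  have hM : 0 ≤ M := (abs_nonneg _).trans (hGb 0)
  have mGX : ∀ t, Measurable fun ω => G (X t ω) := fun t => hGm.comp (hmeas t)
  have mHX : ∀ t, Measurable fun ω => H (X t ω) := fun t => hHm.comp (hmeas t)
  have mGY : ∀ t m, Measurable fun ω => G (Y t m ω) := fun t m => hGm.comp (hY t m)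
  have mHY : ∀ t m, Measurable fun ω => H (Y t m ω) := fun t m => hHm.comp (hY t m)
  have iGX : ∀ t, Integrable (fun ω => G (X t ω)) P := fun t => bdd_integrable (mGX t) fun _ => hGb _
  have iHX : ∀ t, Integrable (fun ω => H (X t ω)) P := fun t => bdd_integrable (mHX t) fun _ => hHb _
  have iGY : ∀ t m, Integrable (fun ω => G (Y t m ω)) P :=
    fun t m => bdd_integrable (mGY t m) fun _ => hGb _
  have iHY : ∀ t m, Integrable (fun ω => H (Y t m ω)) P :=
    fun t m => bdd_integrable (mHY t m) fun _ => hHb _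
  have bm : ∀ {a b : ℝ}, |a| ≤ M → |b| ≤ M → |a * b| ≤ M * M := fun {a b} ha hb => by
    rw [abs_mul]; exact mul_le_mul ha hb (abs_nonneg _) hM
  have iXX : Integrable (fun ω => G (X s ω) * H (X t ω)) P :=
    bdd_integrable ((mGX s).mul (mHX t)) fun ω => bm (hGb _) (hHb _)
  have iYY : Integrable (fun ω => G (Y s m ω) * H (Y t m ω)) P :=
    bdd_integrable ((mGY s m).mul (mHY t m)) fun ω => bm (hGb _) (hHb _)
  have hindep : ∫ ω, G (Y s m ω) * H (Y t m ω) ∂P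
      = (∫ ω, G (Y s m ω) ∂P) * ∫ ω, H (Y t m ω) ∂P :=
    ((ind_pair hind h).comp hGm hHm).integral_mul_eq_mul_integral
      (mGY s m).aestronglyMeasurable (mHY t m).aestronglyMeasurable
  have eG : |∫ ω, G (X s ω) ∂P - ∫ ω, G (Y s m ω) ∂P| ≤ M * ψ m := by
    rw [← integral_sub (iGX s) (iGY s m)]
    exact (abs_integral_le_integral_abs).trans (hGa s m)
  have eH : |∫ ω, H (X t ω) ∂P - ∫ ω, H (Y t m ω) ∂P| ≤ M * ψ m := by
    rw [← integral_sub (iHX t) (iHY t m)]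
    exact (abs_integral_le_integral_abs).trans (hHa t m)
  have bG : |∫ ω, G (X s ω) ∂P| ≤ M := by
    refine (abs_integral_le_integral_abs).trans ?_
    refine (integral_mono (iGX s).abs (integrable_const M) (fun ω => hGb _)).trans (by simp)
  have bH : |∫ ω, H (Y t m ω) ∂P| ≤ M := by
    refine (abs_integral_le_integral_abs).trans ?_
    refine (integral_mono (iHY t m).abs (integrable_const M) (fun ω => hHb _)).trans (by simp)
  have e1 : |∫ ω, G (X s ω) * H (X t ω) ∂P - ∫ ω, G (Y s m ω) * H (Y t m ω) ∂P|
      ≤ 2 * M ^ 2 * ψ m := by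
    rw [← integral_sub iXX iYY]
    refine (abs_integral_le_integral_abs).trans ?_
    have : ∫ ω, |G (X s ω) * H (X t ω) - G (Y s m ω) * H (Y t m ω)| ∂P
        ≤ ∫ ω, (M * |H (X t ω) - H (Y t m ω)| + M * |G (X s ω) - G (Y s m ω)|) ∂P := by
      refine integral_mono (iXX.sub iYY).abs ((((iHX t).sub (iHY t m)).abs.const_mul M).add
        (((iGX s).sub (iGY s m)).abs.const_mul M)) (fun ω => ?_)
      have : G (X s ω) * H (X t ω) - G (Y s m ω) * H (Y t m ω)
        = G (X s ω) * (H (X t ω) - H (Y t m ω)) + H (Y t m ω) * (G (X s ω) - G (Y s m ω)) := by ring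
      simp only
      rw [this]
      refine (abs_add_le _ _).trans ?_
      rw [abs_mul, abs_mul]
      exact add_le_add (mul_le_mul_of_nonneg_right (hGb _) (abs_nonneg _))
        (mul_le_mul_of_nonneg_right (hHb _) (abs_nonneg _))
    refine this.trans ?_
    have j1 : Integrable (fun ω => M * |H (X t ω) - H (Y t m ω)|) P :=
      ((iHX t).sub (iHY t m)).abs.const_mul M
    have j2 : Integrable (fun ω => M * |G (X s ω) - G (Y s m ω)|) P :=
      ((iGX s).sub (iGY s m)).abs.const_mul M
    rw [integral_add j1 j2, integral_const_mul, integral_const_mul]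
    have h1 := mul_le_mul_of_nonneg_left (hHa t m) hM
    have h2 := mul_le_mul_of_nonneg_left (hGa s m) hM
    linarith
  set a := ∫ ω, G (X s ω) ∂P
  set b := ∫ ω, H (X t ω) ∂P
  set a' := ∫ ω, G (Y s m ω) ∂P
  set b' := ∫ ω, H (Y t m ω) ∂P
  have e2 : |a * b - a' * b'| ≤ 2 * M ^ 2 * ψ m := by
    have : a * b - a' * b' = a * (b - b') + b' * (a - a') := by ring
    rw [this]
    refine (abs_add_le _ _).trans ?_
    rw [abs_mul, abs_mul]
    have h1 := mul_le_mul bG eH (abs_nonneg _) hM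
    have h2 := mul_le_mul bH eG (abs_nonneg _) hM
    linarith
  rw [hindep] at e1
  have := abs_sub_le (∫ ω, G (X s ω) * H (X t ω) ∂P) (a' * b') (a * b)
  rw [abs_sub_comm (a' * b')] at this
  linarith

lemma abs_cov_trivial {X : ℤ → Ω → ℝ} (hmeas : ∀ t, Measurable (X t))
    {M : ℝ} {G H : ℝ → ℝ} (hGm : Measurable G) (hHm : Measurable H)
    (hGb : ∀ x, |G x| ≤ M) (hHb : ∀ x, |H x| ≤ M) (s t : ℤ) :
    |∫ ω, G (X s ω) * H (X t ω) ∂P| ≤ M * ∫ ω, |G (X s ω)| ∂P := by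
  have hM : 0 ≤ M := (abs_nonneg _).trans (hGb 0)
  refine (abs_integral_le_integral_abs).trans ?_
  rw [← integral_const_mul]
  have i1 : Integrable (fun ω => G (X s ω)) P := bdd_integrable (hGm.comp (hmeas s)) fun _ => hGb _
  have i2 : Integrable (fun ω => G (X s ω) * H (X t ω)) P :=
    bdd_integrable ((hGm.comp (hmeas s)).mul (hHm.comp (hmeas t))) (C := M * M) fun ω => by
      rw [abs_mul]; exact mul_le_mul (hGb _) (hHb _) (abs_nonneg _) hM
  refine integral_mono i2.abs (i1.abs.const_mul M) fun ω => ?_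
  simp only
  rw [abs_mul, mul_comm]
  exact mul_le_mul_of_nonneg_right (hHb _) (abs_nonneg _)

end basics

/-- Summable majorant. -/
lemma psi_bound {ψ : ℕ → ℝ} 
    (hψ : Tendsto (fun d : ℕ => ((d : ℝ) + 1) ^ 4 * ψ d) atTop (𝓝 0)) :
    ∃ C : ℝ, 0 < C ∧ ∀ h : ℤ, ψ ((h.natAbs - 1) / 2) ≤ C / ((|h| : ℤ) + 1 : ℝ) ^ 2 := by
  obtain ⟨C, hC⟩ := hψ.bddAbove_range
  have hC' : ∀ d : ℕ, ((d : ℝ) + 1) ^ 4 * ψ d ≤ |C| + 1 := fun d =>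
    (hC ⟨d, rfl⟩).trans ((le_abs_self C).trans (by linarith))
  refine ⟨(|C| + 1) * 16, by positivity, fun h => ?_⟩
  set d := (h.natAbs - 1) / 2
  have hd : ((|h| : ℤ) : ℝ) + 1 ≤ 4 * ((d : ℝ) + 1) := by
    have : |h| + 1 ≤ 4 * ((d : ℤ) + 1) := by
      have : h.natAbs + 1 ≤ 4 * (d + 1) := by omega
      rw [Int.abs_eq_natAbs]; exact_mod_cast this
    exact_mod_cast this
  have hp : (0 : ℝ) < ((|h| : ℤ) : ℝ) + 1 := by
    have : (0 : ℝ) ≤ ((|h| : ℤ) : ℝ) := by exact_mod_cast abs_nonneg h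
    linarith
  rw [le_div_iff₀ (by positivity)]
  have h1 : (((|h| : ℤ) : ℝ) + 1) ^ 2 ≤ 16 * ((d : ℝ) + 1) ^ 4 := by
    have a : (((|h| : ℤ) : ℝ) + 1) ^ 2 ≤ (4 * ((d : ℝ) + 1)) ^ 2 := by gcongr
    have b : ((d : ℝ) + 1) ^ 2 ≤ ((d : ℝ) + 1) ^ 4 :=
      pow_le_pow_right₀ (by linarith [Nat.cast_nonneg (α := ℝ) d]) (by norm_num)
    nlinarith
  rcases le_total 0 (ψ d) with h0 | h0
  · have := mul_le_mul_of_nonneg_left h1 h0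
    have := hC' d
    nlinarith
  · have : ψ d * (((|h| : ℤ) : ℝ) + 1) ^ 2 ≤ 0 := mul_nonpos_of_nonpos_of_nonneg h0 (by positivity)
    linarith [show 0 ≤ (|C| + 1) * 16 by positivity]

lemma summable_maj (C : ℝ) : Summable (fun h : ℤ => C / ((|h| : ℤ) + 1 : ℝ) ^ 2) := by
  have hs : Summable (fun n : ℕ => C / ((n : ℝ) + 1) ^ 2) := by
    have := (summable_nat_add_iff 1).2 (Real.summable_one_div_nat_pow.2 (by norm_num : 1 < 2))
    simpa [div_eq_mul_inv] using this.mul_left C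
  refine Summable.of_nat_of_neg ?_ ?_
  · simpa using hs
  · simpa using hs


section variances
set_option linter.unusedSectionVars false
variable {Ω : Type*} [MeasurableSpace Ω] {P : Measure Ω} [IsProbabilityMeasure P]

lemma nice_cov {X : ℤ → Ω → ℝ} (hmeas : ∀ t, Measurable (X t)) {Y : ℤ → ℕ → Ω → ℝ}
    (hY : ∀ t m, Measurable (Y t m)) (hind : IndClause P Y) {ψ : ℕ → ℝ} {C : ℝ}
    (hC0 : 0 < C) (hC : ∀ h : ℤ, ψ ((h.natAbs - 1) / 2) ≤ C / ((|h| : ℤ) + 1 : ℝ) ^ 2)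
    {M : ℝ} {G H : ℝ → ℝ} (hG : NiceFn P X Y ψ M G) (hH : NiceFn P X Y ψ M H)
    (hG0 : ∀ t, ∫ ω, G (X t ω) ∂P = 0) (s t : ℤ) :
    |∫ ω, G (X s ω) * H (X t ω) ∂P|
      ≤ (4 * M ^ 2 * C + M ^ 2) / ((|t - s| : ℤ) + 1 : ℝ) ^ 2 := by
  have hM : 0 ≤ M := (abs_nonneg _).trans (hG.2.1 0)
  by_cases hst : s = t
  · subst hst
    have h1 := abs_cov_trivial (P := P) hmeas hG.1 hH.1 hG.2.1 hH.2.1 s s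
    have h2 : ∫ ω, |G (X s ω)| ∂P ≤ M := by
      refine (integral_mono (bdd_integrable (hG.1.comp (hmeas s)) fun _ => hG.2.1 _).abs
        (integrable_const M) (fun ω => hG.2.1 _)).trans (by simp)
    have h3 := mul_le_mul_of_nonneg_left h2 hM
    simp only [sub_self, abs_zero, Int.cast_zero, zero_add, one_pow, div_one]
    have : 0 ≤ 4 * M ^ 2 * C := by positivity
    nlinarith
  · have hpos : 0 < (t - s).natAbs := by omega
    have hm : 2 * ((((t - s).natAbs - 1) / 2 : ℕ) : ℤ) < |s - t| := by
      rw [abs_sub_comm, Int.abs_eq_natAbs]; omega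
    have h1 := cov_bound hmeas hY hind hG hH hm
    rw [hG0, zero_mul, sub_zero] at h1
    refine h1.trans ((mul_le_mul_of_nonneg_left (hC (t - s)) (by positivity)).trans ?_)
    rw [add_div, mul_div_assoc]
    have : 0 ≤ M ^ 2 / ((|t - s| : ℤ) + 1 : ℝ) ^ 2 := by positivity
    linarith

lemma integral_sq_sum {Z : ℤ → Ω → ℝ} {M : ℝ} (hZ : ∀ t, Measurable (Z t))
    (hb : ∀ t ω, |Z t ω| ≤ M) {ι : Type*} (S : Finset ι) (u : ι → ℤ) :
    ∫ ω, (∑ t ∈ S, Z (u t) ω) ^ 2 ∂P = ∑ s ∈ S, ∑ t ∈ S, ∫ ω, Z (u s) ω * Z (u t) ω ∂P := by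
  have hi : ∀ s t, Integrable (fun ω => Z s ω * Z t ω) P := fun s t =>
    bdd_integrable ((hZ s).mul (hZ t)) (C := M * M) fun ω => by
      rw [abs_mul]
      exact mul_le_mul (hb _ _) (hb _ _) (abs_nonneg _) ((abs_nonneg _).trans (hb s ω))
  simp_rw [sq, Finset.sum_mul_sum]
  rw [integral_finsetSum _ fun s _ => integrable_finsetSum _ fun t _ => hi _ _]
  exact Finset.sum_congr rfl fun s _ => integral_finsetSum _ fun t _ => hi _ _

lemma sum_sq_le {Z : ℤ → Ω → ℝ} {M : ℝ} (hZ : ∀ t, Measurable (Z t))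
    (hb : ∀ t ω, |Z t ω| ≤ M) {c : ℤ → ℝ} (hc : Summable c)
    (hcov : ∀ s t, |∫ ω, Z s ω * Z t ω ∂P| ≤ c (t - s)) (S : Finset ℤ) :
    ∫ ω, (∑ t ∈ S, Z t ω) ^ 2 ∂P ≤ S.card * ∑' h, c h := by
  have hc0 : ∀ h, 0 ≤ c h := fun h => by
    have := (abs_nonneg _).trans (hcov 0 h); simpa using this
  have := integral_sq_sum (P := P) hZ hb S id
  simp only [id] at this
  rw [this]
  have : ∀ s ∈ S, ∑ t ∈ S, ∫ ω, Z s ω * Z t ω ∂P ≤ ∑' h, c h := fun s _ => by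
    calc _ ≤ ∑ t ∈ S, c (t - s) := Finset.sum_le_sum fun t _ => (le_abs_self _).trans (hcov s t)
      _ = ∑ h ∈ S.map (Equiv.subRight s).toEmbedding, c h := by simp
      _ ≤ _ := hc.sum_le_tsum _ fun _ _ => hc0 _
  simpa using Finset.sum_le_sum this

lemma cesaro_cov {r : ℤ → ℝ} (hr : Summable r) :
    Tendsto (fun b : ℕ => (∑ s ∈ Finset.range b, ∑ t ∈ Finset.range b, r ((t : ℤ) - s)) / b) atTop
      (𝓝 (∑' h, r h)) := by
  have key : ∀ b : ℕ, ∑ s ∈ Finset.range b, ∑ t ∈ Finset.range b, r ((t : ℤ) - s)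
      = ∑ j ∈ Finset.range b, ∑ h ∈ Finset.Icc (-(j : ℤ)) j, r h := by
    intro b
    induction b with
    | zero => simp
    | succ b ih =>
      rw [Finset.sum_range_succ, Finset.sum_range_succ (n := b) (f := fun j : ℕ => ∑ h ∈ Finset.Icc (-(j : ℤ)) j, r h), ← ih]
      simp_rw [Finset.sum_range_succ]
      rw [Finset.sum_add_distrib, add_assoc]
      congr 1
      have h1 : ∑ s ∈ Finset.range b, r ((b : ℤ) - s) = ∑ h ∈ Finset.Icc (1 : ℤ) b, r h := by
        refine Finset.sum_bij (fun s _ => (b : ℤ) - s) ?_ ?_ ?_ ?_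
        · intro a ha; simp at ha ⊢; omega
        · intro a _ a' _ h; simp at h; exact h
        · intro h hh; simp at hh; exact ⟨(b - h).toNat, by simp; omega, by omega⟩
        · intros; rfl
      have h2 : ∑ t ∈ Finset.range b, r ((t : ℤ) - b) = ∑ h ∈ Finset.Icc (-(b : ℤ)) (-1), r h := by
        refine Finset.sum_bij (fun s _ => (s : ℤ) - b) ?_ ?_ ?_ ?_
        · intro a ha; simp at ha ⊢; omega
        · intro a _ a' _ h; simp at h; exact h
        · intro h hh; simp at hh; exact ⟨(b + h).toNat, by simp; omega, by omega⟩
        · intros; rfl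
      rw [h1, h2, sub_self]
      have hd : Finset.Icc (-(b : ℤ)) b
          = (Finset.Icc (1 : ℤ) b ∪ Finset.Icc (-(b : ℤ)) (-1)) ∪ {0} := by
        ext x; simp; omega
      rw [hd, Finset.sum_union, Finset.sum_union, Finset.sum_singleton, add_assoc]
      · rw [Finset.disjoint_left]; intro x; simp; omega
      · rw [Finset.disjoint_left]; intro x; simp; omega
  have ht : Tendsto (fun j : ℕ => ∑ h ∈ Finset.Icc (-(j : ℤ)) j, r h) atTop (𝓝 (∑' h, r h)) := by
    have := hr.hasSum
    rw [HasSum] at this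
    simp only [SummationFilter.unconditional_filter] at this
    refine this.comp (tendsto_atTop_finset_of_monotone ?_ ?_)
    · intro a b hab; apply Finset.Icc_subset_Icc <;> omega
    · intro x; exact ⟨x.natAbs, by rw [Finset.mem_Icc]; omega⟩
  refine ht.cesaro.congr fun b => ?_
  rw [key]
  simp [div_eq_inv_mul]

lemma var_limit {X : ℤ → Ω → ℝ} (hmeas : ∀ t, Measurable (X t))
    (hstat : StrictlyStationary P X) {G : ℝ → ℝ} (hG : Measurable G) {M : ℝ}
    (hb : ∀ x, |G x| ≤ M) (hs : Summable fun h : ℤ => ∫ ω, G (X 0 ω) * G (X h ω) ∂P) :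
    Tendsto (fun b : ℕ => (∫ ω, (∑ t ∈ Finset.range b, G (X (t + 1) ω)) ^ 2 ∂P) / b) atTop
      (𝓝 (∑' h, ∫ ω, G (X 0 ω) * G (X h ω) ∂P)) := by
  refine (cesaro_cov hs).congr fun b => ?_
  congr 1
  have := integral_sq_sum (P := P) (Z := fun t ω => G (X t ω)) (fun t => hG.comp (hmeas t))
    (fun t ω => hb _) (Finset.range b) (fun t => (t : ℤ) + 1)
  rw [this]
  refine Finset.sum_congr rfl fun s _ => Finset.sum_congr rfl fun t _ => ?_
  rw [stat_two hmeas hstat hG hG ((s : ℤ) + 1)]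
  simp

end variances


section cf
set_option linter.unusedSectionVars false
variable {Ω : Type*} [MeasurableSpace Ω] {P : Measure Ω} [IsProbabilityMeasure P]

/-- characteristic function of a random variable -/
noncomputable def cfn (P : Measure Ω) (f : Ω → ℝ) (θ : ℝ) : ℂ :=
  ∫ ω, Complex.exp (((θ * f ω : ℝ) : ℂ) * Complex.I) ∂P

lemma cexp_lip (x y : ℝ) :
    ‖Complex.exp ((x : ℂ) * Complex.I) - Complex.exp ((y : ℂ) * Complex.I)‖ ≤ |x - y| := by
  have h1 : Complex.exp ((x : ℂ) * Complex.I) - Complex.exp ((y : ℂ) * Complex.I)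
      = Complex.exp ((y : ℂ) * Complex.I) * (Complex.exp (Complex.I * ((x - y : ℝ) : ℂ)) - 1) := by
    rw [mul_sub, ← Complex.exp_add, mul_one]; congr 2; push_cast; ring
  rw [h1, norm_mul, Complex.norm_exp_ofReal_mul_I, one_mul]
  exact Real.norm_exp_I_mul_ofReal_sub_one_le

lemma cexp_taylor (x : ℝ) :
    ‖Complex.exp ((x : ℂ) * Complex.I) - (1 + (x : ℂ) * Complex.I - (x : ℂ) ^ 2 / 2)‖
      ≤ 4 * |x| ^ 3 := by
  have hn : ‖(x : ℂ) * Complex.I‖ = |x| := by simp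
  rcases le_or_gt |x| 1 with h | h
  · have := Complex.exp_bound (x := (x : ℂ) * Complex.I) (by rw [hn]; exact h) (n := 3) (by norm_num)
    rw [hn] at this
    have e : ∑ m ∈ Finset.range 3, ((x : ℂ) * Complex.I) ^ m / (m.factorial : ℂ)
        = 1 + (x : ℂ) * Complex.I - (x : ℂ) ^ 2 / 2 := by
      simp [Finset.sum_range_succ, mul_pow, Nat.factorial]; ring
    rw [e] at this
    refine this.trans ?_
    rw [mul_comm]
    gcongr
    norm_num [Nat.factorial]
  · have h1 : ‖Complex.exp ((x : ℂ) * Complex.I)‖ = 1 := Complex.norm_exp_ofReal_mul_I x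
    have h2 : ‖(x : ℂ) ^ 2 / 2‖ = |x| ^ 2 / 2 := by simp
    have h3 := norm_sub_le (Complex.exp ((x : ℂ) * Complex.I))
      (1 + (x : ℂ) * Complex.I - (x : ℂ) ^ 2 / 2)
    have h4 := norm_sub_le (1 + (x : ℂ) * Complex.I) ((x : ℂ) ^ 2 / 2)
    have h5 := norm_add_le (1 : ℂ) ((x : ℂ) * Complex.I)
    rw [hn, norm_one] at h5
    have : |x| ≤ |x| ^ 3 := by nlinarith [mul_pos (by linarith : 0 < |x|) (by linarith : 0 < |x|)]
    have : |x| ^ 2 ≤ |x| ^ 3 := by nlinarith [mul_pos (by linarith : 0 < |x|) (by linarith : 0 < |x|)]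
    linarith

lemma cexp_integrable {f : Ω → ℝ} (hf : Measurable f) (θ : ℝ) :
    Integrable (fun ω => Complex.exp (((θ * f ω : ℝ) : ℂ) * Complex.I)) P := by
  refine Integrable.of_bound (Measurable.aestronglyMeasurable (by fun_prop)) 1 (ae_of_all _ ?_)
  intro ω; rw [Complex.norm_exp_ofReal_mul_I]

lemma cfn_norm_le (f : Ω → ℝ) (θ : ℝ) : ‖cfn P f θ‖ ≤ 1 := by
  refine (norm_integral_le_integral_norm _).trans ?_
  simp [Complex.norm_exp_ofReal_mul_I, -Complex.ofReal_mul]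

lemma cfn_lip {f g : Ω → ℝ} (hf : Measurable f) (hg : Measurable g) {K K' : ℝ}
    (hfb : ∀ ω, |f ω| ≤ K) (hgb : ∀ ω, |g ω| ≤ K') (θ : ℝ) :
    ‖cfn P f θ - cfn P g θ‖ ≤ |θ| * ∫ ω, |f ω - g ω| ∂P := by
  unfold cfn
  rw [← integral_sub (cexp_integrable hf θ) (cexp_integrable hg θ), ← integral_const_mul]
  have hi : Integrable (fun ω => |θ| * |f ω - g ω|) P :=
    (((bdd_integrable hf hfb).sub (bdd_integrable hg hgb)).abs).const_mul _
  refine norm_integral_le_of_norm_le hi (ae_of_all _ fun ω => ?_)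
  refine (cexp_lip _ _).trans ?_
  rw [← mul_sub, abs_mul]

lemma l1_le_l2 {f : Ω → ℝ} (hf : Measurable f) {K : ℝ} (hfb : ∀ ω, |f ω| ≤ K) :
    ∫ ω, |f ω| ∂P ≤ Real.sqrt (∫ ω, f ω ^ 2 ∂P) := by
  apply Real.le_sqrt_of_sq_le
  set c := ∫ ω, |f ω| ∂P with hc
  have i1 : Integrable (fun ω => |f ω|) P := (bdd_integrable hf hfb).abs
  have i2 : Integrable (fun ω => f ω ^ 2) P := bdd_integrable (hf.pow_const 2) (C := K ^ 2)
    fun ω => by rw [abs_pow]; exact pow_le_pow_left₀ (abs_nonneg _) (hfb ω) 2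
  have h0 : 0 ≤ ∫ ω, (|f ω| - c) ^ 2 ∂P := integral_nonneg fun ω => sq_nonneg _
  have e : ∀ ω, (|f ω| - c) ^ 2 = f ω ^ 2 - 2 * c * |f ω| + c ^ 2 := fun ω => by
    rw [sub_sq, sq_abs]; ring
  simp_rw [e] at h0
  rw [integral_add (f := fun ω => f ω ^ 2 - 2 * c * |f ω|) (i2.sub (i1.const_mul _))
    (integrable_const _), integral_sub i2 (i1.const_mul _),
    integral_const_mul, ← hc] at h0
  simp at h0
  nlinarith

lemma cfn_taylor {U : Ω → ℝ} (hU : Measurable U) {K : ℝ} (hb : ∀ ω, |U ω| ≤ K)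
    (h0 : ∫ ω, U ω ∂P = 0) (θ : ℝ) :
    ‖cfn P U θ - ((1 - θ ^ 2 * (∫ ω, U ω ^ 2 ∂P) / 2 : ℝ) : ℂ)‖
      ≤ 4 * |θ| ^ 3 * K * ∫ ω, U ω ^ 2 ∂P := by
  have i1 : Integrable U P := bdd_integrable hU hb
  have i2 : Integrable (fun ω => U ω ^ 2) P := bdd_integrable (hU.pow_const 2) (C := K ^ 2)
    fun ω => by rw [abs_pow]; exact pow_le_pow_left₀ (abs_nonneg _) (hb ω) 2
  have e1 : ((1 - θ ^ 2 * (∫ ω, U ω ^ 2 ∂P) / 2 : ℝ) : ℂ)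
      = ∫ ω, (1 + ((θ * U ω : ℝ) : ℂ) * Complex.I - ((θ * U ω : ℝ) : ℂ) ^ 2 / 2) ∂P := by
    have a1 : Integrable (fun ω => ((θ * U ω : ℝ) : ℂ) * Complex.I) P :=
      ((i1.const_mul θ).ofReal).mul_const _
    have a2 : Integrable (fun ω => ((θ * U ω : ℝ) : ℂ) ^ 2 / 2) P := by
      have := ((i2.const_mul (θ ^ 2 / 2)).ofReal (𝕜 := ℂ))
      refine this.congr (ae_of_all _ fun ω => ?_)
      simp; ring
    rw [integral_sub (f := fun ω => 1 + ((θ * U ω : ℝ) : ℂ) * Complex.I)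
      ((integrable_const _).add a1) a2, integral_add (integrable_const _) a1,
      integral_mul_const, integral_complex_ofReal, integral_const_mul, h0]
    have : ∫ ω, ((θ * U ω : ℝ) : ℂ) ^ 2 / 2 ∂P = ((θ ^ 2 / 2 * ∫ ω, U ω ^ 2 ∂P : ℝ) : ℂ) := by
      rw [← integral_const_mul, ← integral_complex_ofReal]
      congr 1; ext ω; push_cast; ring
    rw [this]
    simp; ring
  rw [e1]
  unfold cfn
  rw [← integral_sub (cexp_integrable hU θ), ← integral_const_mul]
  · refine norm_integral_le_of_norm_le (i2.const_mul _) (ae_of_all _ fun ω => ?_)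
    refine (cexp_taylor _).trans ?_
    rw [abs_mul, mul_pow]
    have : |U ω| ^ 3 ≤ K * U ω ^ 2 := by
      rw [pow_succ', sq_abs]; exact mul_le_mul_of_nonneg_right (hb ω) (sq_nonneg _)
    have := mul_le_mul_of_nonneg_left this (show 0 ≤ 4 * |θ| ^ 3 by positivity)
    linarith
  · refine Integrable.of_bound (Measurable.aestronglyMeasurable (by fun_prop))
      (1 + |θ| * K + (|θ| * K) ^ 2 / 2) (ae_of_all _ fun ω => ?_)
    have hx : |θ * U ω| ≤ |θ| * K := by
      rw [abs_mul]; exact mul_le_mul_of_nonneg_left (hb ω) (abs_nonneg _)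
    refine (norm_sub_le _ _).trans (add_le_add ((norm_add_le _ _).trans (add_le_add ?_ ?_)) ?_)
    · simp
    · rw [norm_mul, Complex.norm_I, mul_one, Complex.norm_real]; exact hx
    · rw [norm_div, norm_pow, Complex.norm_real]
      simp only [Complex.norm_ofNat]
      have := pow_le_pow_left₀ (abs_nonneg _) hx 2
      have e : ‖θ * U ω‖ = |θ * U ω| := rfl
      rw [e]; linarith

lemma exp_neg_bound {y : ℝ} (hy : 0 ≤ y) : |Real.exp (-y) - (1 - y)| ≤ y ^ 2 := by
  have h1 := Real.add_one_le_exp (-y)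
  have h2 : Real.exp (-y) ≤ 1 - y + y ^ 2 := by
    rw [Real.exp_neg]
    have h3 := Real.add_one_le_exp y
    have : (Real.exp y)⁻¹ ≤ (1 + y)⁻¹ := by
      apply inv_anti₀ <;> linarith
    refine this.trans ?_
    rw [inv_le_iff_one_le_mul₀ (by linarith)]
    nlinarith [mul_nonneg hy (sq_nonneg y)]
  rw [abs_le]; constructor <;> nlinarith

lemma prod_sub_pow {r : ℕ} (a : Fin r → ℂ) (b : ℂ) (ha : ∀ j, ‖a j‖ ≤ 1) (hb : ‖b‖ ≤ 1) {ε : ℝ}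
    (h : ∀ j, ‖a j - b‖ ≤ ε) : ‖∏ j, a j - b ^ r‖ ≤ r * ε := by
  induction r with
  | zero => simp
  | succ r ih =>
    have ih' := ih (fun j => a j.castSucc) (fun j => ha _) (fun j => h _)
    rw [Fin.prod_univ_castSucc, pow_succ]
    have e : (∏ j : Fin r, a j.castSucc) * a (Fin.last r) - b ^ r * b
      = (∏ j : Fin r, a j.castSucc) * (a (Fin.last r) - b)
        + (∏ j : Fin r, a j.castSucc - b ^ r) * b := by ring
    rw [e]
    refine (norm_add_le _ _).trans ?_
    rw [norm_mul, norm_mul]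
    have h1 : ‖∏ j : Fin r, a j.castSucc‖ ≤ 1 := by
      rw [norm_prod]; exact Finset.prod_le_one (fun _ _ => norm_nonneg _) (fun j _ => ha _)
    have h2 := mul_le_mul h1 (h (Fin.last r)) (norm_nonneg _) zero_le_one
    have h3 := mul_le_mul ih' hb (norm_nonneg _) ((norm_nonneg _).trans ih')
    push_cast
    linarith

lemma cfn_sum_indep {r : ℕ} {V : Fin r → Ω → ℝ} (hV : ∀ j, Measurable (V j))
    (hind : iIndepFun V P) (θ : ℝ) :
    cfn P (fun ω => ∑ j, V j ω) θ = ∏ j, cfn P (V j) θ := by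
  unfold cfn
  have := hind.integral_fun_prod_comp (𝕜 := ℂ) (f := fun _ x => Complex.exp (((θ * x : ℝ) : ℂ) * Complex.I))
    (fun j => (hV j).aemeasurable) (fun j => Measurable.aestronglyMeasurable (by fun_prop))
  rw [← this]
  congr 1; ext ω
  rw [← Complex.exp_sum]
  congr 1
  push_cast
  rw [Finset.mul_sum, Finset.sum_mul]

end cf


section blocks
set_option linter.unusedSectionVars false
variable {Ω : Type*} [MeasurableSpace Ω] {P : Measure Ω} [IsProbabilityMeasure P]

lemma iIndep_mono_le {ι : Type*} {m m' : ι → MeasurableSpace Ω} (h : iIndep m P)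
    (hle : ∀ i, m' i ≤ m i) : iIndep m' P := by
  rw [iIndep_iff] at h ⊢
  intro s f hf
  exact h s fun i hi => hle i _ (hf i hi)

lemma block_indep {Y : ℤ → ℕ → Ω → ℝ} (hind : IndClause P Y) {G : ℝ → ℝ} (hG : Measurable G)
    (d r : ℕ) :
    iIndepFun (fun (j : Fin r) ω =>
      ∑ t ∈ Finset.range (d ^ 2), G (Y (((j : ℕ) * (d + 1) ^ 2 + t + 1 : ℕ) : ℤ) d ω)) P := by
  have h := hind r (fun j => (((j : ℕ) * (d + 1) ^ 2 + 1 : ℕ) : ℤ))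
    (fun j => (((j : ℕ) * (d + 1) ^ 2 + d ^ 2 : ℕ) : ℤ)) (fun _ => d) (by
      have key : ∀ i j : Fin r, i < j → ∀ s ∈ Set.Icc (((i : ℕ) * (d + 1) ^ 2 + 1 : ℕ) : ℤ)
          (((i : ℕ) * (d + 1) ^ 2 + d ^ 2 : ℕ) : ℤ), ∀ t ∈ Set.Icc (((j : ℕ) * (d + 1) ^ 2 + 1 : ℕ) : ℤ)
          (((j : ℕ) * (d + 1) ^ 2 + d ^ 2 : ℕ) : ℤ), (d : ℤ) + d < t - s := by
        intro i j hij s hs t ht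
        have h1 : ((i : ℕ) : ℤ) + 1 ≤ (j : ℕ) := by exact_mod_cast hij
        have h2 := hs.2
        have h3 := ht.1
        push_cast at h2 h3
        have h4 := mul_le_mul_of_nonneg_right h1 (show (0 : ℤ) ≤ ((d : ℤ) + 1) ^ 2 by positivity)
        nlinarith
      intro i j hij s hs t ht
      rcases lt_or_gt_of_ne hij with hlt | hlt
      · have := key i j hlt s hs t ht
        rw [abs_sub_comm]; exact this.trans_le (le_abs_self _)
      · have := key j i hlt t ht s hs
        exact this.trans_le (le_abs_self _))
  rw [iIndepFun_iff_iIndep]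
  refine iIndep_mono_le h fun j => ?_
  rw [← measurable_iff_comap_le]
  refine Finset.measurable_sum _ fun t ht => ?_
  refine hG.comp ?_
  rw [measurable_iff_comap_le]
  refine le_iSup₂_of_le (((j : ℕ) * (d + 1) ^ 2 + t + 1 : ℕ) : ℤ) ?_ le_rfl
  rw [Finset.mem_range] at ht
  constructor
  · push_cast; linarith [Nat.cast_nonneg (α := ℤ) t]
  · have : (t : ℤ) + 1 ≤ (d : ℤ) ^ 2 := by exact_mod_cast ht
    push_cast; linarith

lemma block_decomp (g : ℤ → ℝ) (n d r : ℕ) (hr : r * (d + 1) ^ 2 ≤ n) :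
    ∃ S : Finset ℤ, (S.card : ℝ) = n - r * d ^ 2 ∧
      ∀ g : ℤ → ℝ, ∑ t ∈ Finset.range n, g (t + 1) =
        ∑ j : Fin r, ∑ t ∈ Finset.range (d ^ 2), g (((j : ℕ) * (d + 1) ^ 2 + t + 1 : ℕ) : ℤ)
        + ∑ t ∈ S, g t := by
  classical
  let φ : ℕ × ℕ → ℕ := fun q => q.1 * (d + 1) ^ 2 + q.2
  let Q := Finset.range r ×ˢ Finset.range (d ^ 2)
  have hdN : d ^ 2 < (d + 1) ^ 2 := Nat.pow_lt_pow_left (Nat.lt_succ_self d) (by norm_num)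
  have hinj : Set.InjOn φ Q := by
    rintro ⟨a, b⟩ h1 ⟨a', b'⟩ h2 h
    simp only [Q, Finset.coe_product, Set.mem_prod, Finset.coe_range, Set.mem_Iio] at h1 h2
    have hb : b < (d + 1) ^ 2 := h1.2.trans hdN
    have hb' : b' < (d + 1) ^ 2 := h2.2.trans hdN
    simp only [φ] at h
    have e1 : (a * (d + 1) ^ 2 + b) / (d + 1) ^ 2 = a := by
      rw [mul_comm, Nat.mul_add_div (by positivity), Nat.div_eq_of_lt hb, add_zero]
    have e2 : (a' * (d + 1) ^ 2 + b') / (d + 1) ^ 2 = a' := by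
      rw [mul_comm, Nat.mul_add_div (by positivity), Nat.div_eq_of_lt hb', add_zero]
    have : a = a' := by rw [← e1, ← e2, h]
    subst this
    simp at h; simp [h]
  have hsub : Q.image φ ⊆ Finset.range n := by
    intro x hx
    rw [Finset.mem_image] at hx
    obtain ⟨⟨a, b⟩, hab, rfl⟩ := hx
    simp only [Q, Finset.mem_product, Finset.mem_range] at hab
    rw [Finset.mem_range]
    have : (a + 1) * (d + 1) ^ 2 ≤ r * (d + 1) ^ 2 := Nat.mul_le_mul_right _ hab.1
    simp only [φ]
    nlinarith [hab.2]
  have hcard : (Q.image φ).card = r * d ^ 2 := by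
    rw [Finset.card_image_of_injOn hinj]; simp [Q]
  refine ⟨(Finset.range n \ Q.image φ).map ⟨fun t : ℕ => (t : ℤ) + 1, fun a b h => by simpa using h⟩,
    ?_, ?_⟩
  · rw [Finset.card_map, Finset.card_sdiff_of_subset hsub, hcard, Finset.card_range, Nat.cast_sub]
    · push_cast; ring
    · rw [← hcard]; simpa using Finset.card_le_card hsub
  · intro g
    rw [Finset.sum_map, ← Finset.sum_sdiff hsub, add_comm]
    congr 1
    rw [Finset.sum_image hinj, Finset.sum_product, Finset.sum_range]
    simp [φ]

lemma clt_est {X : ℤ → Ω → ℝ} (hmeas : ∀ t, Measurable (X t)) (hstat : StrictlyStationary P X)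
    {Y : ℤ → ℕ → Ω → ℝ}
    (hY : ∀ t m, Measurable (Y t m)) (hind : IndClause P Y) {ψ : ℕ → ℝ}
    {M : ℝ} {G : ℝ → ℝ} (hG : NiceFn P X Y ψ M G)
    (hG0 : ∀ t, ∫ ω, G (X t ω) ∂P = 0) {R : ℝ}
    (hR : ∀ S : Finset ℤ, ∫ ω, (∑ t ∈ S, G (X t ω)) ^ 2 ∂P ≤ S.card * R)
    (n d r : ℕ) (hr : r * (d + 1) ^ 2 ≤ n) (θ v : ℝ)
    (hv : v = ∫ ω, (∑ t ∈ Finset.range (d ^ 2), G (X (t + 1) ω)) ^ 2 ∂P) :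
    ‖cfn P (fun ω => ∑ t ∈ Finset.range n, G (X (t + 1) ω)) θ
        - ((Real.exp (-(r * (θ ^ 2 * v / 2))) : ℝ) : ℂ)‖
      ≤ |θ| * Real.sqrt ((n - r * d ^ 2) * R) + r * (2 * (|θ| * (d ^ 2 * (M * ψ d)))
        + 4 * |θ| ^ 3 * (d ^ 2 * M) * v + (θ ^ 2 * v / 2) ^ 2) := by
  obtain ⟨hGm, hGb, hGa⟩ := id hG
  have hM : 0 ≤ M := (abs_nonneg _).trans (hGb 0)
  have mGX : ∀ t, Measurable fun ω => G (X t ω) := fun t => hGm.comp (hmeas t)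
  have mGY : ∀ t m, Measurable fun ω => G (Y t m ω) := fun t m => hGm.comp (hY t m)
  have iGX : ∀ t, Integrable (fun ω => G (X t ω)) P := fun t => bdd_integrable (mGX t) fun _ => hGb _
  have iGY : ∀ t m, Integrable (fun ω => G (Y t m ω)) P :=
    fun t m => bdd_integrable (mGY t m) fun _ => hGb _
  have sumb : ∀ {ι : Type} (S : Finset ι) (f : ι → ℝ) (K : ℝ), (∀ i, |f i| ≤ K) →
      |∑ i ∈ S, f i| ≤ S.card * K := by
    intro ι S f K h
    refine (Finset.abs_sum_le_sum_abs _ _).trans ?_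
    simpa using Finset.sum_le_sum (fun i (_ : i ∈ S) => h i)
  set U : Fin r → Ω → ℝ := fun j ω =>
    ∑ t ∈ Finset.range (d ^ 2), G (X (((j : ℕ) * (d + 1) ^ 2 + t + 1 : ℕ) : ℤ) ω) with hU
  set V : Fin r → Ω → ℝ := fun j ω =>
    ∑ t ∈ Finset.range (d ^ 2), G (Y (((j : ℕ) * (d + 1) ^ 2 + t + 1 : ℕ) : ℤ) d ω) with hV
  have mU : ∀ j, Measurable (U j) := fun j => Finset.measurable_sum _ fun t _ => mGX _
  have mV : ∀ j, Measurable (V j) := fun j => Finset.measurable_sum _ fun t _ => mGY _ _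
  have bU : ∀ j ω, |U j ω| ≤ d ^ 2 * M := fun j ω => by
    have h := sumb (Finset.range (d ^ 2)) _ M (fun t => hGb (X (((j : ℕ) * (d + 1) ^ 2 + t + 1 : ℕ) : ℤ) ω))
    rw [Finset.card_range, Nat.cast_pow] at h
    exact h
  have bV : ∀ j ω, |V j ω| ≤ d ^ 2 * M := fun j ω => by
    have h := sumb (Finset.range (d ^ 2)) _ M (fun t => hGb (Y (((j : ℕ) * (d + 1) ^ 2 + t + 1 : ℕ) : ℤ) d ω))
    rw [Finset.card_range, Nat.cast_pow] at h
    exact h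
  have dUV : ∀ j, ∫ ω, |U j ω - V j ω| ∂P ≤ d ^ 2 * (M * ψ d) := by
    intro j
    have i0 : ∀ t : ℕ, Integrable (fun ω => |G (X (((j : ℕ) * (d + 1) ^ 2 + t + 1 : ℕ) : ℤ) ω)
        - G (Y (((j : ℕ) * (d + 1) ^ 2 + t + 1 : ℕ) : ℤ) d ω)|) P :=
      fun t => ((iGX _).sub (iGY _ _)).abs
    calc ∫ ω, |U j ω - V j ω| ∂P ≤ ∫ ω, ∑ t ∈ Finset.range (d ^ 2),
          |G (X (((j : ℕ) * (d + 1) ^ 2 + t + 1 : ℕ) : ℤ) ω)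
          - G (Y (((j : ℕ) * (d + 1) ^ 2 + t + 1 : ℕ) : ℤ) d ω)| ∂P := by
          refine integral_mono ((bdd_integrable (mU j) (bU j)).sub
            (bdd_integrable (mV j) (bV j))).abs (integrable_finsetSum _ fun t _ => i0 t) fun ω => ?_
          simp only [U, V]
          rw [← Finset.sum_sub_distrib]
          exact Finset.abs_sum_le_sum_abs _ _
      _ = ∑ t ∈ Finset.range (d ^ 2), ∫ ω, |G (X (((j : ℕ) * (d + 1) ^ 2 + t + 1 : ℕ) : ℤ) ω)
          - G (Y (((j : ℕ) * (d + 1) ^ 2 + t + 1 : ℕ) : ℤ) d ω)| ∂P :=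
          integral_finsetSum _ fun t _ => i0 t
      _ ≤ ∑ t ∈ Finset.range (d ^ 2), M * ψ d := Finset.sum_le_sum fun t _ => hGa _ _
      _ = _ := by simp
  obtain ⟨S, hScard, hS⟩ := block_decomp (fun _ => 0) n d r hr
  have mUs : Measurable fun ω => ∑ j, U j ω := Finset.measurable_sum _ fun j _ => mU j
  have mVs : Measurable fun ω => ∑ j, V j ω := Finset.measurable_sum _ fun j _ => mV j
  have bUs : ∀ ω, |∑ j, U j ω| ≤ r * (d ^ 2 * M) := fun ω => by
    simpa using sumb (Finset.univ : Finset (Fin r)) _ _ (fun j => bU j ω)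
  have bVs : ∀ ω, |∑ j, V j ω| ≤ r * (d ^ 2 * M) := fun ω => by
    simpa using sumb (Finset.univ : Finset (Fin r)) _ _ (fun j => bV j ω)
  -- step 1
  have s1 : ‖cfn P (fun ω => ∑ t ∈ Finset.range n, G (X (t + 1) ω)) θ - cfn P (fun ω => ∑ j, U j ω) θ‖
      ≤ |θ| * Real.sqrt ((n - r * d ^ 2) * R) := by
    refine (cfn_lip (K := n * M) (Finset.measurable_sum _ fun t _ => mGX _) mUs (fun ω => by
      simpa using sumb (Finset.range n) _ M (fun t => hGb (X (t + 1) ω))) bUs θ).trans ?_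
    refine mul_le_mul_of_nonneg_left ?_ (abs_nonneg _)
    have e : ∀ ω, ∑ t ∈ Finset.range n, G (X (t + 1) ω) - ∑ j, U j ω = ∑ t ∈ S, G (X t ω) := fun ω => by
      rw [hS (fun t => G (X t ω))]; simp [U]
    simp_rw [e]
    refine (l1_le_l2 (K := S.card * M) (Finset.measurable_sum _ fun t _ => mGX _)
      (fun ω => sumb S _ M (fun t => hGb (X t ω)))).trans ?_
    apply Real.sqrt_le_sqrt
    rw [← hScard]; exact hR S
  -- step 2
  have s2 : ‖cfn P (fun ω => ∑ j, U j ω) θ - ∏ j, cfn P (V j) θ‖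
      ≤ r * (|θ| * (d ^ 2 * (M * ψ d))) := by
    rw [← cfn_sum_indep mV (block_indep hind hGm d r) θ]
    refine (cfn_lip mUs mVs bUs bVs θ).trans ?_
    have : ∫ ω, |∑ j, U j ω - ∑ j, V j ω| ∂P ≤ r * (d ^ 2 * (M * ψ d)) := by
      have i0 : ∀ j, Integrable (fun ω => |U j ω - V j ω|) P := fun j =>
        ((bdd_integrable (mU j) (bU j)).sub (bdd_integrable (mV j) (bV j))).abs
      calc _ ≤ ∫ ω, ∑ j, |U j ω - V j ω| ∂P := by
            refine integral_mono ((bdd_integrable mUs bUs).sub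
              (bdd_integrable mVs bVs)).abs (integrable_finsetSum _ fun t _ => i0 t) fun ω => ?_
            simp only
            rw [← Finset.sum_sub_distrib]
            exact Finset.abs_sum_le_sum_abs _ _
        _ = ∑ j, ∫ ω, |U j ω - V j ω| ∂P := integral_finsetSum _ fun t _ => i0 t
        _ ≤ ∑ j : Fin r, (d ^ 2 * (M * ψ d) : ℝ) := Finset.sum_le_sum fun j _ => dUV j
        _ = _ := by simp
    have := mul_le_mul_of_nonneg_left this (abs_nonneg θ)
    linarith
  -- step 3
  have mU0 : Measurable fun ω => ∑ t ∈ Finset.range (d ^ 2), G (X (t + 1) ω) :=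
    Finset.measurable_sum _ fun t _ => mGX _
  have bU0 : ∀ ω, |∑ t ∈ Finset.range (d ^ 2), G (X (t + 1) ω)| ≤ d ^ 2 * M := fun ω => by
    have h := sumb (Finset.range (d ^ 2)) _ M (fun t => hGb (X (t + 1) ω))
    rw [Finset.card_range, Nat.cast_pow] at h
    exact h
  have cU : ∀ j, cfn P (U j) θ
      = cfn P (fun ω => ∑ t ∈ Finset.range (d ^ 2), G (X (t + 1) ω)) θ := by
    intro j
    have := stat_integral hmeas hstat (d ^ 2) (fun t => (t : ℤ) + 1) (((j : ℕ) * (d + 1) ^ 2 : ℕ) : ℤ)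
      (fun x => Complex.exp (((θ * ∑ t, G (x t) : ℝ) : ℂ) * Complex.I)) (by fun_prop)
    unfold cfn
    simp only [U, Finset.sum_range]
    rw [← this]
    congr 1; ext ω; congr 4
    refine Finset.sum_congr rfl fun t _ => ?_
    congr 2; push_cast; ring
  have hv0 : 0 ≤ v := by rw [hv]; exact integral_nonneg fun ω => sq_nonneg _
  set y := θ ^ 2 * v / 2 with hy
  have hy0 : 0 ≤ y := by positivity
  have t3 : ∀ j, ‖cfn P (V j) θ - ((Real.exp (-y) : ℝ) : ℂ)‖
      ≤ |θ| * (d ^ 2 * (M * ψ d)) + 4 * |θ| ^ 3 * (d ^ 2 * M) * v + y ^ 2 := by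
    intro j
    have h1 : ‖cfn P (V j) θ - cfn P (U j) θ‖ ≤ |θ| * (d ^ 2 * (M * ψ d)) := by
      rw [norm_sub_rev]
      exact (cfn_lip (mU j) (mV j) (bU j) (bV j) θ).trans
        (mul_le_mul_of_nonneg_left (dUV j) (abs_nonneg _))
    have h2 : ‖cfn P (U j) θ - ((1 - y : ℝ) : ℂ)‖ ≤ 4 * |θ| ^ 3 * (d ^ 2 * M) * v := by
      rw [cU]
      have := cfn_taylor mU0 bU0 (P := P) (by
        rw [integral_finsetSum _ fun t _ => iGX _]; exact Finset.sum_eq_zero fun t _ => hG0 _) θ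
      rw [← hv] at this
      exact this
    have h3 : ‖((1 - y : ℝ) : ℂ) - ((Real.exp (-y) : ℝ) : ℂ)‖ ≤ y ^ 2 := by
      rw [norm_sub_rev, ← Complex.ofReal_sub, Complex.norm_real]
      exact exp_neg_bound hy0
    have e : cfn P (V j) θ - ((Real.exp (-y) : ℝ) : ℂ) = (cfn P (V j) θ - cfn P (U j) θ)
      + (cfn P (U j) θ - ((1 - y : ℝ) : ℂ)) + (((1 - y : ℝ) : ℂ) - ((Real.exp (-y) : ℝ) : ℂ)) := by ring
    rw [e]
    exact (norm_add₃_le).trans (by linarith)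
  have s3 := prod_sub_pow (fun j => cfn P (V j) θ) ((Real.exp (-y) : ℝ) : ℂ)
    (fun j => cfn_norm_le _ _) (by
      rw [Complex.norm_real, Real.norm_eq_abs, abs_of_pos (Real.exp_pos _)]
      exact Real.exp_le_one_iff.2 (by linarith)) t3
  have e : ((Real.exp (-(r * y)) : ℝ) : ℂ) = ((Real.exp (-y) : ℝ) : ℂ) ^ r := by
    rw [← Complex.ofReal_pow, ← Real.exp_nat_mul]; congr 2; ring
  rw [e]
  set w1 := cfn P (fun ω => ∑ t ∈ Finset.range n, G (X (t + 1) ω)) θ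
  set w2 := cfn P (fun ω => ∑ j, U j ω) θ
  set w3 := ∏ j, cfn P (V j) θ
  have e2 : w1 - ((Real.exp (-y) : ℝ) : ℂ) ^ r
    = (w1 - w2) + (w2 - w3) + (w3 - ((Real.exp (-y) : ℝ) : ℂ) ^ r) := by ring
  rw [e2]
  exact (norm_add₃_le).trans (by linarith)

end blocks


section clt
set_option linter.unusedSectionVars false
variable {Ω : Type*} [MeasurableSpace Ω] {P : Measure Ω} [IsProbabilityMeasure P]

/-- Block length parameter. -/
def dd (n : ℕ) : ℕ := Nat.findGreatest (fun d => d ^ 8 ≤ n) n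

lemma dd_le (n : ℕ) : (dd n) ^ 8 ≤ n :=
  Nat.findGreatest_spec (P := fun d => d ^ 8 ≤ n) (Nat.zero_le n) (by simp)

lemma lt_dd (n : ℕ) : n < (dd n + 1) ^ 8 := by
  by_contra h
  push Not at h
  have h1 : dd n + 1 ≤ n := (Nat.le_self_pow (by norm_num) _).trans h
  have := Nat.le_findGreatest (P := fun d => d ^ 8 ≤ n) h1 h
  unfold dd at this
  omega

lemma dd_tendsto : Tendsto dd atTop atTop := by
  refine tendsto_atTop.2 fun b => ?_
  filter_upwards [eventually_ge_atTop (b ^ 8)] with n hn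
  exact Nat.le_findGreatest ((Nat.le_self_pow (by norm_num) _).trans hn) hn

/-- fraction of points in large blocks -/
noncomputable def rho (n : ℕ) : ℝ := ((n / (dd n + 1) ^ 2 : ℕ) : ℝ) * (dd n : ℝ) ^ 2 / n

lemma rho_le (n : ℕ) : rho n ≤ 1 := by
  unfold rho
  apply div_le_one_of_le₀ _ (Nat.cast_nonneg _)
  have h : n / (dd n + 1) ^ 2 * (dd n) ^ 2 ≤ n :=
    (Nat.mul_le_mul_left _ (Nat.pow_le_pow_left (Nat.le_succ _) 2)).trans (Nat.div_mul_le_self _ _)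
  exact_mod_cast h

lemma rho_nonneg (n : ℕ) : 0 ≤ rho n := by unfold rho; positivity

lemma dd_inv_tendsto : Tendsto (fun n => ((dd n : ℝ))⁻¹) atTop (𝓝 0) :=
  tendsto_inv_atTop_zero.comp (tendsto_natCast_atTop_atTop.comp dd_tendsto)

lemma rho_tendsto : Tendsto rho atTop (𝓝 1) := by
  have h1 : Tendsto (fun n => 1 - 3 * ((dd n : ℝ))⁻¹) atTop (𝓝 1) := by
    simpa using (dd_inv_tendsto.const_mul 3).const_sub 1
  refine tendsto_of_tendsto_of_tendsto_of_le_of_le' h1 tendsto_const_nhds ?_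
    (Eventually.of_forall rho_le)
  filter_upwards [dd_tendsto.eventually_ge_atTop 1] with n hn
  have hD : (1 : ℝ) ≤ dd n := by exact_mod_cast hn
  have hn8 : (dd n : ℝ) ^ 8 ≤ n := by exact_mod_cast dd_le n
  have hr : (n : ℝ) < (((n / (dd n + 1) ^ 2 : ℕ) : ℝ) + 1) * ((dd n : ℝ) + 1) ^ 2 := by
    have := Nat.lt_div_mul_add (a := n) (b := (dd n + 1) ^ 2) (by positivity)
    have h2 : n < (n / (dd n + 1) ^ 2 + 1) * (dd n + 1) ^ 2 := by
      rw [add_mul, one_mul]; exact this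
    exact_mod_cast h2
  unfold rho
  set D : ℝ := (dd n : ℝ)
  have hn0 : (0 : ℝ) < n := lt_of_lt_of_le (by positivity) hn8
  set r : ℝ := ((n / (dd n + 1) ^ 2 : ℕ) : ℝ)
  have hr2 : (n : ℝ) / (D + 1) ^ 2 - 1 ≤ r := by
    rw [sub_le_iff_le_add, div_le_iff₀ (by positivity)]; exact hr.le
  have h3 : ((n : ℝ) / (D + 1) ^ 2 - 1) * D ^ 2 / n ≤ r * D ^ 2 / n := by gcongr
  refine le_trans ?_ h3
  have e : ((n : ℝ) / (D + 1) ^ 2 - 1) * D ^ 2 / n = D ^ 2 / (D + 1) ^ 2 - D ^ 2 / n := by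
    field_simp
  have h4 : D ^ 2 / n ≤ D⁻¹ := by
    rw [div_le_iff₀ hn0, ← div_eq_inv_mul, le_div_iff₀ (by positivity)]
    refine le_trans ?_ hn8
    calc D ^ 2 * D = D ^ 3 := by ring
      _ ≤ D ^ 8 := pow_le_pow_right₀ hD (by norm_num)
  have h5 : 1 - 2 * D⁻¹ ≤ D ^ 2 / (D + 1) ^ 2 := by
    rw [le_div_iff₀ (by positivity)]
    have : D * D⁻¹ = 1 := mul_inv_cancel₀ (by positivity)
    have h0 : 0 ≤ D⁻¹ := by positivity
    have : (1 - 2 * D⁻¹) * (D + 1) ^ 2 = D ^ 2 + 2 * D + 1 - 2 * (D * D⁻¹) * D - 4 * (D * D⁻¹) - 2 * D⁻¹ := by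
      ring
    rw [this, mul_inv_cancel₀ (by positivity)]
    linarith
  rw [e]; linarith

lemma clt_cfn {X : ℤ → Ω → ℝ} (hmeas : ∀ t, Measurable (X t)) (hstat : StrictlyStationary P X)
    {Y : ℤ → ℕ → Ω → ℝ}
    (hY : ∀ t m, Measurable (Y t m)) (hind : IndClause P Y) {ψ : ℕ → ℝ} (hψ0 : ∀ m, 0 ≤ ψ m)
    (hψ : Tendsto (fun d : ℕ => ((d : ℝ) + 1) ^ 4 * ψ d) atTop (𝓝 0))
    {M : ℝ} {G : ℝ → ℝ} (hG : NiceFn P X Y ψ M G)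
    (hG0 : ∀ t, ∫ ω, G (X t ω) ∂P = 0) (s : ℝ) :
    Tendsto (fun n : ℕ => cfn P (fun ω => ∑ t ∈ Finset.range n, G (X (t + 1) ω)) (s / Real.sqrt n))
      atTop (𝓝 ((Real.exp (-(s ^ 2 / 2 * ∑' h, ∫ ω, G (X 0 ω) * G (X h ω) ∂P)) : ℝ) : ℂ)) := by
  have hM : 0 ≤ M := (abs_nonneg _).trans (hG.2.1 0)
  obtain ⟨C, hC0, hC⟩ := psi_bound hψ
  have hcov := nice_cov hmeas hY hind hC0 hC hG hG hG0
  have hsm := summable_maj (4 * M ^ 2 * C + M ^ 2)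
  set R := ∑' h : ℤ, (4 * M ^ 2 * C + M ^ 2) / ((|h| : ℤ) + 1 : ℝ) ^ 2 with hRdef
  have hR0 : 0 ≤ R := tsum_nonneg fun h => by positivity
  have hR : ∀ S : Finset ℤ, ∫ ω, (∑ t ∈ S, G (X t ω)) ^ 2 ∂P ≤ S.card * R := fun S =>
    sum_sq_le (Z := fun t ω => G (X t ω)) (fun t => hG.1.comp (hmeas t)) (fun t ω => hG.2.1 _) hsm
      hcov S
  have hs : Summable fun h : ℤ => ∫ ω, G (X 0 ω) * G (X h ω) ∂P :=
    Summable.of_norm_bounded hsm fun h => by simpa using hcov 0 h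
  have hvl := var_limit (P := P) hmeas hstat hG.1 hG.2.1 hs
  set σ2 := ∑' h, ∫ ω, G (X 0 ω) * G (X h ω) ∂P
  set v : ℕ → ℝ := fun b => ∫ ω, (∑ t ∈ Finset.range b, G (X (t + 1) ω)) ^ 2 ∂P with hv
  have hv0 : ∀ b, 0 ≤ v b := fun b => integral_nonneg fun ω => sq_nonneg _
  have hvR : ∀ b : ℕ, v b ≤ b * R := fun b => by
    have := hR ((Finset.range b).map ⟨fun t : ℕ => (t : ℤ) + 1, fun a b h => by simpa using h⟩)
    rw [Finset.card_map, Finset.card_range] at this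
    simp only [Finset.sum_map] at this
    exact this
  have hd2 : Tendsto (fun n => dd n ^ 2) atTop atTop :=
    (tendsto_pow_atTop (by norm_num)).comp dd_tendsto
  have hlim1 : Tendsto (fun n => ((Real.exp (-(s ^ 2 / 2 * (rho n * (v (dd n ^ 2) / ((dd n ^ 2 : ℕ) : ℝ))))) : ℝ) : ℂ))
      atTop (𝓝 ((Real.exp (-(s ^ 2 / 2 * σ2)) : ℝ) : ℂ)) := by
    have h := (rho_tendsto.mul (hvl.comp hd2))
    rw [one_mul] at h
    exact (Complex.continuous_ofReal.tendsto _).comp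
      ((Real.continuous_exp.tendsto _).comp ((h.const_mul (s ^ 2 / 2)).neg))
  set bd : ℕ → ℝ := fun n => |s| * Real.sqrt ((1 - rho n) * R)
    + 2 * M * |s| * (((dd n : ℝ) + 1) ^ 4 * ψ (dd n))
    + (4 * |s| ^ 3 * M * R + s ^ 4 * R ^ 2) * ((dd n : ℝ))⁻¹ with hbd
  have hlim2 : Tendsto bd atTop (𝓝 0) := by
    have h1 : Tendsto (fun n => |s| * Real.sqrt ((1 - rho n) * R)) atTop (𝓝 0) := by
      have := ((Real.continuous_sqrt.tendsto _).comp ((rho_tendsto.const_sub 1).mul_const R)).const_mul |s|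
      simpa using this
    have h2 := (hψ.comp dd_tendsto).const_mul (2 * M * |s|)
    have h3 := dd_inv_tendsto.const_mul (4 * |s| ^ 3 * M * R + s ^ 4 * R ^ 2)
    have := (h1.add h2).add h3
    simpa [bd] using this
  have key : ∀ᶠ n : ℕ in atTop, ‖cfn P (fun ω => ∑ t ∈ Finset.range n, G (X (t + 1) ω)) (s / Real.sqrt n)
      - ((Real.exp (-(s ^ 2 / 2 * (rho n * (v (dd n ^ 2) / ((dd n ^ 2 : ℕ) : ℝ))))) : ℝ) : ℂ)‖ ≤ bd n := by
    filter_upwards [dd_tendsto.eventually_ge_atTop 1] with n hn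
    have hest := clt_est hmeas hstat hY hind hG hG0 hR n (dd n) (n / (dd n + 1) ^ 2)
      (Nat.div_mul_le_self _ _) (s / Real.sqrt n) (v (dd n ^ 2)) rfl
    have hD : (1 : ℝ) ≤ dd n := by exact_mod_cast hn
    have hn8 : (dd n : ℝ) ^ 8 ≤ n := by exact_mod_cast dd_le n
    have hn8' : (n : ℝ) ≤ ((dd n : ℝ) + 1) ^ 8 := by exact_mod_cast (lt_dd n).le
    have hψd := hψ0 (dd n)
    have hvd : v (dd n ^ 2) ≤ (dd n : ℝ) ^ 2 * R := by
      have h := hvR (dd n ^ 2)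
      rw [Nat.cast_pow] at h
      exact h
    have hvd0 := hv0 (dd n ^ 2)
    have hρ1 := rho_le n
    have hρ0 := rho_nonneg n
    have hρ : rho n = ((n / (dd n + 1) ^ 2 : ℕ) : ℝ) * (dd n : ℝ) ^ 2 / n := rfl
    have hr0 : (0 : ℝ) ≤ ((n / (dd n + 1) ^ 2 : ℕ) : ℝ) := Nat.cast_nonneg _
    simp only [bd]
    rw [Nat.cast_pow]
    generalize rho n = ρ at *
    generalize v (dd n ^ 2) = w at *
    generalize ψ (dd n) = y at *
    generalize ((n / (dd n + 1) ^ 2 : ℕ) : ℝ) = r at *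
    generalize (dd n : ℝ) = D at *
    have hn0 : (0 : ℝ) < n := lt_of_lt_of_le (by positivity) hn8
    generalize hN : (n : ℝ) = N at *
    obtain ⟨q, hq0, hq⟩ : ∃ q : ℝ, 0 < q ∧ N = q ^ 2 :=
      ⟨Real.sqrt N, Real.sqrt_pos.2 hn0, (Real.sq_sqrt hn0.le).symm⟩
    subst hq
    rw [Real.sqrt_sq hq0.le] at *
    have hq1 : D ^ 4 ≤ q := by
      apply le_of_sq_le_sq _ hq0.le; rw [← pow_mul]; exact hn8
    have hq2 : q ≤ (D + 1) ^ 4 := by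
      apply le_of_sq_le_sq _ (by positivity); rw [← pow_mul]; exact hn8'
    have hrD : r * D ^ 2 = ρ * q ^ 2 := by rw [hρ]; field_simp
    have e1 : r * ((s / q) ^ 2 * w / 2) = s ^ 2 / 2 * (ρ * (w / D ^ 2)) := by
      rw [hρ]; field_simp
    rw [e1] at hest
    refine hest.trans ?_
    have a1 : |s / q| * Real.sqrt ((q ^ 2 - r * D ^ 2) * R) = |s| * Real.sqrt ((1 - ρ) * R) := by
      rw [hrD, show (q ^ 2 - ρ * q ^ 2) * R = q ^ 2 * ((1 - ρ) * R) by ring,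
        Real.sqrt_mul (by positivity), Real.sqrt_sq hq0.le, abs_div, abs_of_pos hq0]
      field_simp
    have a2 : r * (2 * (|s / q| * (D ^ 2 * (M * y)))) ≤ 2 * M * |s| * ((D + 1) ^ 4 * y) := by
      rw [abs_div, abs_of_pos hq0]
      calc r * (2 * (|s| / q * (D ^ 2 * (M * y)))) = 2 * M * |s| * (r * D ^ 2 / q * y) := by ring
        _ = 2 * M * |s| * (ρ * q * y) := by rw [hrD]; congr 3; field_simp
        _ ≤ 2 * M * |s| * ((D + 1) ^ 4 * y) := by
          gcongr
          exact (mul_le_of_le_one_left hq0.le hρ1).trans hq2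
    have hqi : D ^ 2 / q ≤ D⁻¹ := by
      rw [div_le_iff₀ hq0, ← div_eq_inv_mul, le_div_iff₀ (by positivity)]
      refine le_trans ?_ hq1
      calc D ^ 2 * D = D ^ 3 := by ring
        _ ≤ D ^ 4 := pow_le_pow_right₀ hD (by norm_num)
    have hq1' : 1 ≤ q := (one_le_pow₀ hD).trans hq1
    have a3 : r * (4 * |s / q| ^ 3 * (D ^ 2 * M) * w) ≤ (4 * |s| ^ 3 * M * R) * D⁻¹ := by
      rw [abs_div, abs_of_pos hq0]
      calc r * (4 * (|s| / q) ^ 3 * (D ^ 2 * M) * w)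
          ≤ r * (4 * (|s| / q) ^ 3 * (D ^ 2 * M) * (D ^ 2 * R)) := by gcongr
        _ = 4 * |s| ^ 3 * M * R * ((r * D ^ 2) * D ^ 2 / q ^ 3) := by ring
        _ = 4 * |s| ^ 3 * M * R * (ρ * (D ^ 2 / q)) := by rw [hrD]; congr 1; field_simp
        _ ≤ 4 * |s| ^ 3 * M * R * (1 * D⁻¹) := by gcongr
        _ = _ := by ring
    have a4 : r * ((s / q) ^ 2 * w / 2) ^ 2 ≤ s ^ 4 * R ^ 2 * D⁻¹ := by
      calc r * ((s / q) ^ 2 * w / 2) ^ 2 ≤ r * ((s / q) ^ 2 * (D ^ 2 * R) / 2) ^ 2 := by gcongr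
        _ = s ^ 4 * R ^ 2 * ((r * D ^ 2) * D ^ 2 / q ^ 4 / 4) := by ring
        _ = s ^ 4 * R ^ 2 * (ρ * (D ^ 2 / q) * q⁻¹ / 4) := by rw [hrD]; congr 1; field_simp
        _ ≤ s ^ 4 * R ^ 2 * (1 * D⁻¹ * 1 / 1) := by
          gcongr
          · exact inv_le_one_of_one_le₀ hq1'
          · norm_num
        _ = _ := by ring
    rw [a1]
    have : r * (2 * (|s / q| * (D ^ 2 * (M * y))) + 4 * |s / q| ^ 3 * (D ^ 2 * M) * w
      + ((s / q) ^ 2 * w / 2) ^ 2) = r * (2 * (|s / q| * (D ^ 2 * (M * y))))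
      + r * (4 * |s / q| ^ 3 * (D ^ 2 * M) * w) + r * ((s / q) ^ 2 * w / 2) ^ 2 := by ring
    rw [this]
    linarith
  have h0 := squeeze_zero_norm' key hlim2
  have := h0.add hlim1
  simpa using this

end clt


/-- indicator of `y ≤ x` -/
noncomputable def ind (x y : ℝ) : ℝ := if y ≤ x then 1 else 0

section dist
set_option linter.unusedSectionVars false
variable {Ω : Type*} [MeasurableSpace Ω] {P : Measure Ω} [IsProbabilityMeasure P]

lemma ind_measurable (x : ℝ) : Measurable (ind x) :=
  Measurable.ite measurableSet_Iic measurable_const measurable_const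

lemma ind_nonneg (x y : ℝ) : 0 ≤ ind x y := by unfold ind; split_ifs <;> norm_num

lemma ind_le_one (x y : ℝ) : ind x y ≤ 1 := by unfold ind; split_ifs <;> norm_num

lemma ind_abs (x y : ℝ) : |ind x y| ≤ 1 := by
  rw [abs_of_nonneg (ind_nonneg _ _)]; exact ind_le_one _ _

lemma ind_integral {X : ℤ → Ω → ℝ} (hmeas : ∀ t, Measurable (X t))
    (hstat : StrictlyStationary P X) {F : ℝ → ℝ} (hF : ∀ x, F x = (P {ω | X 0 ω ≤ x}).toReal)
    (x : ℝ) (t : ℤ) : ∫ ω, ind x (X t ω) ∂P = F x := by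
  rw [stat_one hmeas hstat (ind_measurable x) t, hF]
  have : (fun ω => ind x (X 0 ω)) = Set.indicator {ω | X 0 ω ≤ x} (fun _ => (1 : ℝ)) := by
    ext ω; simp [ind, Set.indicator]
  rw [this, integral_indicator (measurableSet_le (hmeas 0) measurable_const)]
  simp [Measure.real]


lemma F_cdf {X : ℤ → Ω → ℝ} (hmeas : ∀ t, Measurable (X t))
    {F : ℝ → ℝ} (hF : ∀ x, F x = (P {ω | X 0 ω ≤ x}).toReal) : F = cdf (P.map (X 0)) := by
  have : IsProbabilityMeasure (P.map (X 0)) := Measure.isProbabilityMeasure_map (hmeas 0).aemeasurable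
  ext x
  rw [cdf_eq_real, hF, Measure.real, Measure.map_apply (hmeas 0) measurableSet_Iic]
  rfl

/-- The distribution function facts we use. -/
structure DF (F : ℝ → ℝ) : Prop where
  mono : Monotone F
  top : Tendsto F atTop (𝓝 1)
  bot : Tendsto F atBot (𝓝 0)

lemma F_df {X : ℤ → Ω → ℝ} (hmeas : ∀ t, Measurable (X t))
    {F : ℝ → ℝ} (hF : ∀ x, F x = (P {ω | X 0 ω ≤ x}).toReal) : DF F := by
  rw [F_cdf hmeas hF]
  exact ⟨monotone_cdf _, tendsto_cdf_atTop _, tendsto_cdf_atBot _⟩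

lemma f_int {F f : ℝ → ℝ} (h : DF F) (hdens : ∀ x, F x = ∫ s in Set.Iic x, f s) (x : ℝ) :
    IntegrableOn f (Set.Iic x) := by
  by_contra hx
  have h0 : ∀ᶠ y in atTop, F y = 0 := by
    filter_upwards [eventually_ge_atTop x] with y hy
    rw [hdens]
    exact integral_undef fun h' => hx (IntegrableOn.mono_set h' (Set.Iic_subset_Iic.2 hy))
  have h1 : Tendsto F atTop (𝓝 0) := tendsto_const_nhds.congr' (h0.mono fun y hy => hy.symm)
  exact zero_ne_one (tendsto_nhds_unique h1 h.top)

lemma F_sub {F f : ℝ → ℝ} (h : DF F) (hdens : ∀ x, F x = ∫ s in Set.Iic x, f s) (x y : ℝ) :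
    F y - F x = ∫ s in x..y, f s := by
  rw [hdens, hdens]
  exact intervalIntegral.integral_Iic_sub_Iic (f_int h hdens x) (f_int h hdens y)

lemma f_ii {F f : ℝ → ℝ} (h : DF F) (hdens : ∀ x, F x = ∫ s in Set.Iic x, f s) (x y : ℝ) :
    IntervalIntegrable f volume x y :=
  ⟨(f_int h hdens y).mono_set Set.Ioc_subset_Iic_self, (f_int h hdens x).mono_set Set.Ioc_subset_Iic_self⟩

lemma F_lip {F f : ℝ → ℝ} (h : DF F) (hdens : ∀ x, F x = ∫ s in Set.Iic x, f s)
    {B : ℝ} (hfB : ∀ x, f x ≤ B) {x y : ℝ} (hxy : x ≤ y) : F y - F x ≤ B * (y - x) := by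
  rw [F_sub h hdens]
  refine (intervalIntegral.integral_mono_on hxy (f_ii h hdens x y) intervalIntegrable_const
    fun s _ => hfB s).trans (le_of_eq ?_)
  simp [mul_comm]

lemma B_nonneg {F f : ℝ → ℝ} (h : DF F) (hdens : ∀ x, F x = ∫ s in Set.Iic x, f s)
    {B : ℝ} (hfB : ∀ x, f x ≤ B) : 0 ≤ B := by
  have h1 := F_lip h hdens hfB (zero_le_one (α := ℝ))
  have h2 := h.mono (zero_le_one (α := ℝ))
  linarith

lemma F_lip_abs {F f : ℝ → ℝ} (h : DF F) (hdens : ∀ x, F x = ∫ s in Set.Iic x, f s)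
    {B : ℝ} (hfB : ∀ x, f x ≤ B) (x y : ℝ) : |F y - F x| ≤ B * |y - x| := by
  rcases le_total x y with hxy | hxy
  · rw [abs_of_nonneg (sub_nonneg.2 (h.mono hxy)), abs_of_nonneg (sub_nonneg.2 hxy)]
    exact F_lip h hdens hfB hxy
  · rw [abs_sub_comm, abs_sub_comm y, abs_of_nonneg (sub_nonneg.2 (h.mono hxy)),
      abs_of_nonneg (sub_nonneg.2 hxy)]
    exact F_lip h hdens hfB hxy

lemma F_cont {F f : ℝ → ℝ} (h : DF F) (hdens : ∀ x, F x = ∫ s in Set.Iic x, f s)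
    {B : ℝ} (hfB : ∀ x, f x ≤ B) : Continuous F := by
  have : LipschitzWith (Real.toNNReal B) F := by
    refine LipschitzWith.of_dist_le_mul fun x y => ?_
    rw [Real.dist_eq, Real.dist_eq, Real.coe_toNNReal _ (B_nonneg h hdens hfB)]
    exact F_lip_abs h hdens hfB y x
  exact this.continuous

lemma F_deriv {F f : ℝ → ℝ} (h : DF F) (hdens : ∀ x, F x = ∫ s in Set.Iic x, f s)
    {x : ℝ} (hc : ContinuousAt f x) : HasDerivAt F (f x) x := by
  have h1 : HasDerivAt (fun y => ∫ s in x..y, f s) (f x) x :=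
    intervalIntegral.integral_hasDerivAt_right (f_ii h hdens x x)
      (AEStronglyMeasurable.stronglyMeasurableAtFilter_of_mem
        (f_int h hdens (x + 1)).aestronglyMeasurable (Iic_mem_nhds (by linarith))) hc
  have h2 : F = fun y => F x + ∫ s in x..y, f s := by
    ext y; rw [← F_sub h hdens]; ring
  rw [h2]
  exact h1.const_add _

lemma F_quant {F : ℝ → ℝ} (h : DF F) (hc : Continuous F) {p : ℝ} (h0 : 0 < p) (h1 : p < 1) :
    F (quantileOf F p) = p := by
  obtain ⟨b, hb⟩ := (h.top.eventually (lt_mem_nhds h1)).exists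
  obtain ⟨a, ha⟩ := (h.bot.eventually (gt_mem_nhds h0)).exists
  have hne : {x | p ≤ F x}.Nonempty := ⟨b, hb.le⟩
  have hbd : BddBelow {x | p ≤ F x} := ⟨a, fun x hx => by
    by_contra hxa
    push Not at hxa
    have := h.mono hxa.le
    have : p ≤ F x := hx
    linarith⟩
  have hcl : IsClosed {x | p ≤ F x} := isClosed_le continuous_const hc
  have hm : p ≤ F (quantileOf F p) := hcl.csInf_mem hne hbd
  refine le_antisymm ?_ hm
  by_contra hlt
  push Not at hlt
  have h2 : ∀ᶠ y in 𝓝[<] (quantileOf F p), p < F y :=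
    (hc.continuousAt.eventually (lt_mem_nhds hlt)).filter_mono nhdsWithin_le_nhds
  obtain ⟨y, hy1, hy2⟩ := (h2.and self_mem_nhdsWithin).exists
  have : quantileOf F p ≤ y := csInf_le hbd hy1.le
  exact absurd hy2 (not_lt.2 this)

lemma ind_approx {X : ℤ → Ω → ℝ} (hmeas : ∀ t, Measurable (X t))
    (hstat : StrictlyStationary P X)
    {γ δ : ℕ → ℝ} (hmix : SMixing P X γ δ)
    {A : ℝ} (hA : 4 < A)
    {Cγ : ℝ} (hγ : ∀ m : ℕ, 1 ≤ m → |γ m| ≤ Cγ * (m : ℝ) ^ (-A))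
    {Cδ : ℝ} (hδ : ∀ m : ℕ, 1 ≤ m → |δ m| ≤ Cδ * (m : ℝ) ^ (-A))
    {F f : ℝ → ℝ} (hF : ∀ x, F x = (P {ω | X 0 ω ≤ x}).toReal)
    (hdens : ∀ x, F x = ∫ s in Set.Iic x, f s)
    {B : ℝ} (hfB : ∀ x, f x ≤ B) :
    ∃ (Y : ℤ → ℕ → Ω → ℝ) (ψ : ℕ → ℝ), (∀ t m, Measurable (Y t m)) ∧ IndClause P Y ∧
      (∀ m, 0 ≤ ψ m) ∧ Tendsto (fun d : ℕ => ((d : ℝ) + 1) ^ 4 * ψ d) atTop (𝓝 0) ∧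
      ∀ x t m, ∫ ω, |ind x (X t ω) - ind x (Y t m ω)| ∂P ≤ ψ m := by
  obtain ⟨-, -, Y, hY, hXY, hind⟩ := hmix
  have hdf := F_df hmeas hF
  have hB := B_nonneg hdf hdens hfB
  have hCγ : 0 ≤ Cγ := by simpa using (abs_nonneg _).trans (hγ 1 le_rfl)
  have hCδ : 0 ≤ Cδ := by simpa using (abs_nonneg _).trans (hδ 1 le_rfl)
  set K := Cδ + B * (2 * Cγ) with hK
  have hK0 : 0 ≤ K := by positivity
  refine ⟨Y, fun m => if m = 0 then 1 else K * (m : ℝ) ^ (-A), hY, hind, ?_, ?_, ?_⟩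
  · intro m; dsimp only; split_ifs <;> positivity
  · have h1 : Tendsto (fun m : ℕ => 16 * K * (m : ℝ) ^ (-(A - 4))) atTop (𝓝 0) := by
      have := ((tendsto_rpow_neg_atTop (show 0 < A - 4 by linarith)).comp
        tendsto_natCast_atTop_atTop).const_mul (16 * K)
      simpa using this
    refine tendsto_of_tendsto_of_tendsto_of_le_of_le' tendsto_const_nhds h1 ?_ ?_
    · refine Eventually.of_forall fun m => ?_
      dsimp only; split_ifs <;> positivity
    · filter_upwards [eventually_ge_atTop 1] with m hm
      have hm' : (1 : ℝ) ≤ m := by exact_mod_cast hm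
      rw [if_neg (by omega)]
      have e : (m : ℝ) ^ (-(A - 4)) = (m : ℝ) ^ 4 * (m : ℝ) ^ (-A) := by
        rw [show -(A - 4) = (4 : ℕ) + -A by push_cast; ring, Real.rpow_add (by linarith),
          Real.rpow_natCast]
      rw [e]
      have : ((m : ℝ) + 1) ^ 4 ≤ 16 * (m : ℝ) ^ 4 := by
        calc ((m : ℝ) + 1) ^ 4 ≤ (m + m : ℝ) ^ 4 := by gcongr
          _ = _ := by ring
      calc ((m : ℝ) + 1) ^ 4 * (K * (m : ℝ) ^ (-A)) ≤ (16 * (m : ℝ) ^ 4) * (K * (m : ℝ) ^ (-A)) := by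
            gcongr
        _ = _ := by ring
  · intro x t m
    have mi : Measurable fun ω => |ind x (X t ω) - ind x (Y t m ω)| :=
      (((ind_measurable x).comp (hmeas t)).sub ((ind_measurable x).comp (hY t m))).abs
    have b1 : ∀ ω, |ind x (X t ω) - ind x (Y t m ω)| ≤ 1 := fun ω =>
      abs_sub_le_of_nonneg_of_le (ind_nonneg _ _) (ind_le_one _ _) (ind_nonneg _ _) (ind_le_one _ _)
    have ii : Integrable (fun ω => |ind x (X t ω) - ind x (Y t m ω)|) P :=
      bdd_integrable mi (C := 1) fun ω => by rw [abs_abs]; exact b1 ω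
    dsimp only
    split_ifs with hm
    · refine (integral_mono ii (integrable_const 1) b1).trans ?_
      simp
    · have hm1 : 1 ≤ m := by omega
      have hγm := hγ m hm1
      have hδm := hδ m hm1
      set E : Set Ω := {ω | γ m ≤ |X t ω - Y t m ω|} with hE
      have mE : MeasurableSet E :=
        measurableSet_le measurable_const ((hmeas t).sub (hY t m)).abs
      set g := |γ m|
      have i1 : Integrable (E.indicator fun _ => (1 : ℝ)) P :=
        (integrable_const 1).indicator mE
      have i2 : ∀ y, Integrable (fun ω => ind y (X t ω)) P := fun y =>
        bdd_integrable ((ind_measurable y).comp (hmeas t)) (C := 1) fun ω => ind_abs _ _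
      have hle : ∀ ω, |ind x (X t ω) - ind x (Y t m ω)| ≤
          E.indicator (fun _ => (1 : ℝ)) ω + (ind (x + g) (X t ω) - ind (x - g) (X t ω)) := by
        intro ω
        have hg : γ m ≤ g := le_abs_self _
        have hg0 : 0 ≤ g := abs_nonneg _
        have hmon : 0 ≤ ind (x + g) (X t ω) - ind (x - g) (X t ω) := by
          unfold ind; split_ifs <;> first | (norm_num; done) | (exfalso; linarith)
        by_cases hω : ω ∈ E
        · rw [Set.indicator_of_mem hω]; linarith [b1 ω]
        · rw [Set.indicator_of_notMem hω, zero_add]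
          have hω' : |X t ω - Y t m ω| < γ m := not_le.1 hω
          rw [abs_lt] at hω'
          unfold ind
          split_ifs <;> first | (norm_num; done) | (exfalso; linarith)
      have hint := integral_mono ii (i1.add ((i2 _).sub (i2 _))) hle
      simp only [Pi.add_apply, Pi.sub_apply] at hint
      refine hint.trans ?_
      have i3 : Integrable (fun ω => ind (x + g) (X t ω) - ind (x - g) (X t ω)) P := (i2 _).sub (i2 _)
      rw [integral_add i1 i3, integral_sub (i2 _) (i2 _),
        ind_integral hmeas hstat hF, ind_integral hmeas hstat hF, integral_indicator mE]
      have e1 : ∫ _ in E, (1 : ℝ) ∂P = (P E).toReal := by simp [Measure.real]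
      rw [e1]
      have e2 := hXY t m
      have e3 := F_lip hdf hdens hfB (show x - g ≤ x + g by have : 0 ≤ g := abs_nonneg _; linarith)
      have e4 : B * (x + g - (x - g)) ≤ B * (2 * Cγ) * (m : ℝ) ^ (-A) := by
        calc B * (x + g - (x - g)) = B * (2 * g) := by ring
          _ ≤ B * (2 * (Cγ * (m : ℝ) ^ (-A))) := by gcongr
          _ = _ := by ring
      have e5 := le_abs_self (δ m)
      rw [hK, add_mul]
      linarith

lemma NiceFn.add {X : ℤ → Ω → ℝ} (hmeas : ∀ t, Measurable (X t)) {Y : ℤ → ℕ → Ω → ℝ}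
    (hY : ∀ t m, Measurable (Y t m)) {ψ : ℕ → ℝ} {M M' : ℝ} {G H : ℝ → ℝ}
    (hG : NiceFn P X Y ψ M G) (hH : NiceFn P X Y ψ M' H) :
    NiceFn P X Y ψ (M + M') (fun x => G x + H x) := by
  refine ⟨hG.1.add hH.1, fun x => (abs_add_le _ _).trans (add_le_add (hG.2.1 x) (hH.2.1 x)), fun t m => ?_⟩
  have i1 : Integrable (fun ω => |G (X t ω) - G (Y t m ω)|) P :=
    ((bdd_integrable (hG.1.comp (hmeas t)) fun _ => hG.2.1 _).sub
      (bdd_integrable (hG.1.comp (hY t m)) fun _ => hG.2.1 _)).abs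
  have i2 : Integrable (fun ω => |H (X t ω) - H (Y t m ω)|) P :=
    ((bdd_integrable (hH.1.comp (hmeas t)) fun _ => hH.2.1 _).sub
      (bdd_integrable (hH.1.comp (hY t m)) fun _ => hH.2.1 _)).abs
  have h3 := integral_mono_of_nonneg (μ := P)
    (f := fun ω => |G (X t ω) + H (X t ω) - (G (Y t m ω) + H (Y t m ω))|)
    (ae_of_all _ fun ω => abs_nonneg _) (i1.add i2)
    (ae_of_all _ fun ω => by
      show _ ≤ |G (X t ω) - G (Y t m ω)| + |H (X t ω) - H (Y t m ω)|
      refine le_trans (le_of_eq ?_) (abs_add_le _ _)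
      ring_nf)
  refine h3.trans ?_
  simp only [Pi.add_apply]
  rw [integral_add i1 i2, add_mul]
  exact add_le_add (hG.2.2 t m) (hH.2.2 t m)

lemma NiceFn.smul {X : ℤ → Ω → ℝ} {Y : ℤ → ℕ → Ω → ℝ}
    {ψ : ℕ → ℝ} {M : ℝ} {G : ℝ → ℝ}
    (hG : NiceFn P X Y ψ M G) (a : ℝ) :
    NiceFn P X Y ψ (|a| * M) (fun x => a * G x) := by
  refine ⟨hG.1.const_mul a, fun x => ?_, fun t m => ?_⟩
  · rw [abs_mul]; exact mul_le_mul_of_nonneg_left (hG.2.1 x) (abs_nonneg _)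
  · simp_rw [← mul_sub, abs_mul]
    rw [integral_const_mul, mul_assoc]
    exact mul_le_mul_of_nonneg_left (hG.2.2 t m) (abs_nonneg _)

lemma NiceFn.sum {X : ℤ → Ω → ℝ} (hmeas : ∀ t, Measurable (X t)) {Y : ℤ → ℕ → Ω → ℝ}
    (hY : ∀ t m, Measurable (Y t m)) {ψ : ℕ → ℝ} {ι : Type*} {M : ι → ℝ}
    {G : ι → ℝ → ℝ} (hG : ∀ i, NiceFn P X Y ψ (M i) (G i)) (a : ι → ℝ) (s : Finset ι) :
    NiceFn P X Y ψ (∑ i ∈ s, |a i| * M i) (fun x => ∑ i ∈ s, a i * G i x) := by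
  classical
  induction s using Finset.induction_on with
  | empty => simp [NiceFn]
  | insert i s hi ih =>
    simp only [Finset.sum_insert hi]
    exact NiceFn.add hmeas hY ((hG i).smul (a i)) ih

/-- centered indicator -/
noncomputable def ctr (F : ℝ → ℝ) (x y : ℝ) : ℝ := ind x y - F x

lemma ctr_nice {X : ℤ → Ω → ℝ} {Y : ℤ → ℕ → Ω → ℝ} {ψ : ℕ → ℝ}
    {F : ℝ → ℝ} (hF : ∀ x, F x = (P {ω | X 0 ω ≤ x}).toReal)
    (h : ∀ x t m, ∫ ω, |ind x (X t ω) - ind x (Y t m ω)| ∂P ≤ ψ m) (x : ℝ) :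
    NiceFn P X Y ψ 1 (ctr F x) := by
  have h1 : 0 ≤ F x := by rw [hF]; exact ENNReal.toReal_nonneg
  have h2 : F x ≤ 1 := by
    rw [hF]; exact measureReal_le_one (μ := P)
  refine ⟨(ind_measurable x).sub_const _, fun y => ?_, fun t m => ?_⟩
  · exact abs_sub_le_of_nonneg_of_le (ind_nonneg _ _) (ind_le_one _ _) h1 h2
  · simpa [ctr] using h x t m

lemma ctr_zero {X : ℤ → Ω → ℝ} (hmeas : ∀ t, Measurable (X t))
    (hstat : StrictlyStationary P X) {F : ℝ → ℝ} (hF : ∀ x, F x = (P {ω | X 0 ω ≤ x}).toReal)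
    (x : ℝ) (t : ℤ) : ∫ ω, ctr F x (X t ω) ∂P = 0 := by
  unfold ctr
  have i1 : Integrable (fun ω => ind x (X t ω)) P :=
    bdd_integrable ((ind_measurable x).comp (hmeas t)) (C := 1) fun ω => ind_abs _ _
  rw [integral_sub i1 (integrable_const _), ind_integral hmeas hstat hF]
  simp

end dist


section bahadur
set_option linter.unusedSectionVars false
variable {Ω : Type*} [MeasurableSpace Ω] {P : Measure Ω} [IsProbabilityMeasure P]

lemma cheb {Z : Ω → ℝ} (hZ : Measurable Z) {K : ℝ} (hb : ∀ ω, |Z ω| ≤ K) {ε : ℝ} (hε : 0 < ε) :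
    P {ω | ε ≤ |Z ω|} ≤ ENNReal.ofReal ((∫ ω, (Z ω) ^ 2 ∂P) / ε ^ 2) := by
  have hi : Integrable (fun ω => (Z ω) ^ 2) P := bdd_integrable (hZ.pow_const 2) (C := K ^ 2) fun ω => by
    rw [abs_pow]; exact pow_le_pow_left₀ (abs_nonneg _) (hb ω) 2
  have h := mul_meas_ge_le_integral_of_nonneg (μ := P) (ae_of_all _ fun ω => sq_nonneg (Z ω)) hi (ε ^ 2)
  have e : {ω | ε ^ 2 ≤ (Z ω) ^ 2} = {ω | ε ≤ |Z ω|} := by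
    ext ω
    simp only [Set.mem_setOf_eq]
    rw [← sq_abs (Z ω), sq_le_sq₀ hε.le (abs_nonneg _)]
  rw [e] at h
  rw [← ofReal_measureReal]
  apply ENNReal.ofReal_le_ofReal
  rw [le_div_iff₀ (by positivity), mul_comm]
  exact h

lemma ghosh {V W : ℕ → Ω → ℝ} {W' : ℝ → ℕ → Ω → ℝ} {un : ℝ → ℕ → ℝ}
    (ha : ∀ u, ∀ᶠ n in atTop, ∀ ω, V n ω ≤ u ↔ W' u n ω ≤ un u n)
    (hb : ∀ u, Tendsto (un u) atTop (𝓝 u))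
    (hc : ∀ u ε, 0 < ε → Tendsto (fun n => P {ω | ε ≤ |W' u n ω - W n ω|}) atTop (𝓝 0))
    (hd : ∀ η : ENNReal, 0 < η → ∃ L : ℝ, ∀ᶠ n in atTop, P {ω | L ≤ |W n ω|} ≤ η)
    {ε : ℝ} (hε : 0 < ε) : Tendsto (fun n => P {ω | ε ≤ |V n ω - W n ω|}) atTop (𝓝 0) := by
  rw [ENNReal.tendsto_nhds_zero]
  intro η hη
  have hη2 : 0 < η / 2 := ENNReal.half_pos hη.ne'
  obtain ⟨L, hL⟩ := hd (η / 2) hη2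
  set e := ε / 2 with he
  have he0 : 0 < e := by positivity
  set N : ℤ := ⌈L / e⌉ + 3
  set J : Finset ℤ := Finset.Icc (-N) N
  have hsum : Tendsto (fun n => ∑ j ∈ J, P {ω | e / 4 ≤ |W' (j * e) n ω - W n ω|}) atTop (𝓝 0) := by
    have := tendsto_finsetSum J fun j _ => hc (j * e) (e / 4) (by positivity)
    simpa using this
  have h1 : ∀ᶠ n in atTop, ∀ j ∈ J, ∀ ω, V n ω ≤ j * e ↔ W' (j * e) n ω ≤ un (j * e) n :=
    (Finset.eventually_all J).2 fun j _ => ha (j * e)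
  have h2 : ∀ᶠ n in atTop, ∀ j ∈ J, |un (j * e) n - j * e| < e / 4 :=
    (Finset.eventually_all J).2 fun j _ => by
      have := (Metric.tendsto_nhds.1 (hb (j * e))) (e / 4) (by positivity)
      simpa [Real.dist_eq] using this
  filter_upwards [hL, h1, h2, (ENNReal.tendsto_nhds_zero.1 hsum) (η / 2) hη2] with n hLn h1 h2 h3
  have hsub : {ω | ε ≤ |V n ω - W n ω|} ⊆ {ω | L ≤ |W n ω|} ∪
      ⋃ j ∈ J, {ω | e / 4 ≤ |W' (j * e) n ω - W n ω|} := by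
    intro ω hω
    by_contra hcon
    simp only [Set.mem_union, Set.mem_iUnion, Set.mem_setOf_eq, not_or, not_exists, not_le] at hcon
    obtain ⟨hW, hJ⟩ := hcon
    have hWe : |W n ω / e| < L / e := by
      rw [abs_div, abs_of_pos he0]; exact div_lt_div_of_pos_right hW he0
    rw [abs_lt] at hWe
    have hLe : L / e ≤ ⌈L / e⌉ := Int.le_ceil _
    have c1 := Int.le_ceil (W n ω / e)
    have c2 := Int.ceil_lt_add_one (W n ω / e)
    have f1 := Int.floor_le (W n ω / e)
    have f2 := Int.lt_floor_add_one (W n ω / e)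
    have hWeq : W n ω / e * e = W n ω := by field_simp
    have jm1 : ⌈W n ω / e⌉ + 1 ∈ J := by
      rw [Finset.mem_Icc]
      constructor
      · have : (-((⌈L / e⌉ : ℤ) : ℝ) - 3) ≤ (⌈W n ω / e⌉ : ℝ) + 1 := by linarith
        have : -⌈L / e⌉ - 3 ≤ ⌈W n ω / e⌉ + 1 := by exact_mod_cast this
        omega
      · have : (⌈W n ω / e⌉ : ℝ) + 1 ≤ ((⌈L / e⌉ : ℤ) : ℝ) + 3 := by linarith
        have : ⌈W n ω / e⌉ + 1 ≤ ⌈L / e⌉ + 3 := by exact_mod_cast this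
        omega
    have jm2 : ⌊W n ω / e⌋ - 1 ∈ J := by
      rw [Finset.mem_Icc]
      constructor
      · have : (-((⌈L / e⌉ : ℤ) : ℝ) - 3) ≤ (⌊W n ω / e⌋ : ℝ) - 1 := by linarith
        have : -⌈L / e⌉ - 3 ≤ ⌊W n ω / e⌋ - 1 := by exact_mod_cast this
        omega
      · have : (⌊W n ω / e⌋ : ℝ) - 1 ≤ ((⌈L / e⌉ : ℤ) : ℝ) + 3 := by linarith
        have : ⌊W n ω / e⌋ - 1 ≤ ⌈L / e⌉ + 3 := by exact_mod_cast this
        omega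
    have q1 := hJ _ jm1
    have q2 := hJ _ jm2
    have r1 := h2 _ jm1
    have r2 := h2 _ jm2
    have b1 := (h1 _ jm1 ω)
    have b2 := (h1 _ jm2 ω)
    have g1 : W n ω + e ≤ ((⌈W n ω / e⌉ + 1 : ℤ) : ℝ) * e := by
      push_cast; nlinarith
    have g2 : ((⌈W n ω / e⌉ + 1 : ℤ) : ℝ) * e < W n ω + 2 * e := by
      push_cast; nlinarith
    have g3 : ((⌊W n ω / e⌋ - 1 : ℤ) : ℝ) * e ≤ W n ω - e := by
      push_cast; nlinarith
    have g4 : W n ω - 2 * e < ((⌊W n ω / e⌋ - 1 : ℤ) : ℝ) * e := by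
      push_cast; nlinarith
    rw [abs_lt] at q1 q2 r1 r2
    have v1 := b1.2 (by linarith [q1.2, r1.1])
    have v2 : ((⌊W n ω / e⌋ - 1 : ℤ) : ℝ) * e < V n ω := by
      by_contra hh
      have := b2.1 (not_lt.1 hh)
      linarith [q2.1, r2.2]
    have : |V n ω - W n ω| < ε := by rw [abs_lt]; constructor <;> linarith
    exact absurd hω (not_le.2 this)
  calc P {ω | ε ≤ |V n ω - W n ω|} ≤ _ := measure_mono hsub
    _ ≤ P {ω | L ≤ |W n ω|} + ∑ j ∈ J, P {ω | e / 4 ≤ |W' (j * e) n ω - W n ω|} :=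
      (measure_union_le _ _).trans (add_le_add le_rfl (measure_biUnion_finset_le _ _))
    _ ≤ η / 2 + η / 2 := add_le_add hLn h3
    _ = η := ENNReal.add_halves η

lemma emp_le_iff {X : ℤ → Ω → ℝ} {n : ℕ} (hn : 1 ≤ n) {p : ℝ} (h0 : 0 < p) (h1 : p < 1) (ω : Ω) (x : ℝ) :
    empQuantileZ X n p ω ≤ x ↔ p ≤ (n : ℝ)⁻¹ * ∑ t ∈ Finset.range n, ind x (X (t + 1) ω) := by
  set Fn : ℝ → ℝ := fun x => (n : ℝ)⁻¹ * ∑ t ∈ Finset.range n, ind x (X (t + 1) ω) with hFn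
  have e : empQuantileZ X n p ω = sInf {x | p ≤ Fn x} := rfl
  have hn0 : (0 : ℝ) < n := by exact_mod_cast hn
  have hmono : Monotone Fn := by
    intro a b hab
    simp only [Fn]
    gcongr with t _
    unfold ind; split_ifs <;> first | (norm_num; done) | (exfalso; linarith)
  have hbig : ∃ b, ∀ t ∈ Finset.range n, |X (t + 1) ω| ≤ b :=
    ⟨∑ t ∈ Finset.range n, |X (t + 1) ω|, fun t ht =>
      Finset.single_le_sum (f := fun t : ℕ => |X (t + 1) ω|) (fun i _ => abs_nonneg _) ht⟩
  obtain ⟨b, hb⟩ := hbig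
  have hne : {x | p ≤ Fn x}.Nonempty := by
    refine ⟨b, ?_⟩
    have : Fn b = 1 := by
      simp only [Fn]
      rw [Finset.sum_congr rfl (g := fun _ => (1 : ℝ)) fun t ht => by
        unfold ind; rw [if_pos ((le_abs_self _).trans (hb t ht))]]
      simp; field_simp
    show p ≤ Fn b
    rw [this]; exact h1.le
  have hbd : BddBelow {x | p ≤ Fn x} := by
    refine ⟨-b - 1, fun x hx => ?_⟩
    by_contra hlt
    push Not at hlt
    have : Fn x = 0 := by
      simp only [Fn]
      rw [Finset.sum_eq_zero, mul_zero]
      intro t ht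
      unfold ind
      rw [if_neg]
      have := (abs_le.1 (hb t ht)).1
      linarith
    have hx' : p ≤ Fn x := hx
    linarith
  have hmem : p ≤ Fn (sInf {x | p ≤ Fn x}) := by
    set q := sInf {x | p ≤ Fn x}
    have hev : ∀ᶠ y in 𝓝 q, ∀ t ∈ Finset.range n, q ≤ y → ind y (X (t + 1) ω) = ind q (X (t + 1) ω) := by
      refine (Finset.eventually_all _).2 fun t _ => ?_
      by_cases h : X (t + 1) ω ≤ q
      · refine Eventually.of_forall fun y hy => ?_
        simp [ind, h, h.trans hy]
      · filter_upwards [gt_mem_nhds (not_le.1 h)] with y hy _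
        simp [ind, h, hy]
    obtain ⟨r, hr0, hr⟩ := Metric.eventually_nhds_iff.1 hev
    obtain ⟨a, ha, haq⟩ := exists_lt_of_csInf_lt hne (show sInf {x | p ≤ Fn x} < q + r by
      show q < q + r; linarith)
    have hqa : q ≤ a := csInf_le hbd ha
    have : Fn a = Fn q := by
      simp only [Fn]
      congr 1
      refine Finset.sum_congr rfl fun t ht => hr (y := a) ?_ t ht hqa
      rw [Real.dist_eq, abs_of_nonneg (by linarith)]; linarith
    rw [← this]; exact ha
  rw [e]
  constructor
  · intro h; exact hmem.trans (hmono h)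
  · intro h; exact csInf_le hbd h

lemma emp_meas {X : ℤ → Ω → ℝ} (hmeas : ∀ t, Measurable (X t)) (n : ℕ) {p : ℝ} (h0 : 0 < p) (h1 : p < 1) :
    Measurable (empQuantileZ X n p) := by
  rcases Nat.eq_zero_or_pos n with rfl | hn
  · have : empQuantileZ X 0 p = fun _ => quantileOf (fun _ => 0) p := by
      ext ω; simp [empQuantileZ]
    rw [this]; exact measurable_const
  · refine measurable_of_Iic fun x => ?_
    have : empQuantileZ X n p ⁻¹' Set.Iic x
        = {ω | p ≤ (n : ℝ)⁻¹ * ∑ t ∈ Finset.range n, ind x (X (t + 1) ω)} := by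
      ext ω; exact emp_le_iff hn h0 h1 ω x
    rw [this]
    exact measurableSet_le measurable_const
      ((Finset.measurable_sum _ fun t _ => (ind_measurable x).comp (hmeas _)).const_mul _)

lemma tsum_min_tendsto {c : ℤ → ℝ} (hc0 : ∀ h, 0 ≤ c h) (hc : Summable c) {ε : ℕ → ℝ}
    (hε0 : ∀ n, 0 ≤ ε n) (hε : Tendsto ε atTop (𝓝 0)) :
    Tendsto (fun n => ∑' h, min (c h) (ε n)) atTop (𝓝 0) := by
  have h := tendsto_tsum_of_dominated_convergence (𝓕 := atTop) (f := fun n h => min (c h) (ε n))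
    (g := fun _ => (0 : ℝ)) hc (fun h => ?_) (Eventually.of_forall fun n h => ?_)
  · simpa using h
  · have := (tendsto_const_nhds (x := c h)).min hε
    rwa [min_eq_right (hc0 h)] at this
  · rw [Real.norm_eq_abs, abs_of_nonneg (le_min (hc0 h) (hε0 n))]
    exact min_le_left _ _

end bahadur


section bahadur2
set_option linter.unusedSectionVars false
variable {Ω : Type*} [MeasurableSpace Ω] {P : Measure Ω} [IsProbabilityMeasure P]

/-- Bundled working hypotheses. -/
structure Ctx {Ω : Type*} [MeasurableSpace Ω] (P : Measure Ω) (X : ℤ → Ω → ℝ)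
    (Y : ℤ → ℕ → Ω → ℝ) (ψ : ℕ → ℝ) (F : ℝ → ℝ) (B C : ℝ) : Prop where
  hmeas : ∀ t, Measurable (X t)
  hstat : StrictlyStationary P X
  hY : ∀ t m, Measurable (Y t m)
  hind : IndClause P Y
  hψ0 : ∀ m, 0 ≤ ψ m
  hψ : Tendsto (fun d : ℕ => ((d : ℝ) + 1) ^ 4 * ψ d) atTop (𝓝 0)
  hC0 : 0 < C
  hC : ∀ h : ℤ, ψ ((h.natAbs - 1) / 2) ≤ C / ((|h| : ℤ) + 1 : ℝ) ^ 2
  hF : ∀ x, F x = (P {ω | X 0 ω ≤ x}).toReal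
  happ : ∀ x t m, ∫ ω, |ind x (X t ω) - ind x (Y t m ω)| ∂P ≤ ψ m
  mono : Monotone F
  hB : 0 ≤ B
  lip : ∀ x y, |F y - F x| ≤ B * |y - x|

variable {X : ℤ → Ω → ℝ} {Y : ℤ → ℕ → Ω → ℝ} {ψ : ℕ → ℝ} {F : ℝ → ℝ} {B C : ℝ}

lemma Ctx.ind_int (c : Ctx P X Y ψ F B C) (x : ℝ) (t : ℤ) : Integrable (fun ω => ind x (X t ω)) P :=
  bdd_integrable ((ind_measurable x).comp (c.hmeas t)) (C := 1) fun ω => ind_abs _ _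

lemma Ctx.ind_diff (c : Ctx P X Y ψ F B C) (x y : ℝ) (t : ℤ) :
    ∫ ω, |ind x (X t ω) - ind y (X t ω)| ∂P = |F x - F y| := by
  have key : ∀ a b : ℝ, a ≤ b → ∫ ω, |ind b (X t ω) - ind a (X t ω)| ∂P = |F b - F a| := by
    intro a b hab
    have : ∀ ω, |ind b (X t ω) - ind a (X t ω)| = ind b (X t ω) - ind a (X t ω) := fun ω => by
      rw [abs_of_nonneg]
      unfold ind; split_ifs <;> first | (norm_num; done) | (exfalso; linarith)
    simp_rw [this]
    rw [integral_sub (c.ind_int _ _) (c.ind_int _ _), ind_integral c.hmeas c.hstat c.hF,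
      ind_integral c.hmeas c.hstat c.hF, abs_of_nonneg (sub_nonneg.2 (c.mono hab))]
  rcases le_total x y with h | h
  · simp_rw [abs_sub_comm (ind x _)]; rw [abs_sub_comm]; exact key x y h
  · exact key y x h

lemma Ctx.diff_nice (c : Ctx P X Y ψ F B C) (x y : ℝ) :
    NiceFn P X Y ψ 2 (fun z => ctr F x z - ctr F y z) := by
  have := NiceFn.add c.hmeas c.hY (ctr_nice c.hF c.happ x) ((ctr_nice c.hF c.happ y).smul (-1))
  convert this using 1
  · norm_num
  · ext z; ring

lemma Ctx.ctr_int (c : Ctx P X Y ψ F B C) (x : ℝ) (t : ℤ) : Integrable (fun ω => ctr F x (X t ω)) P :=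
  bdd_integrable ((ctr_nice c.hF c.happ x).1.comp (c.hmeas t)) (C := 1)
    fun ω => (ctr_nice c.hF c.happ x).2.1 _

lemma Ctx.diff_l1 (c : Ctx P X Y ψ F B C) (x y : ℝ) (t : ℤ) :
    ∫ ω, |ctr F x (X t ω) - ctr F y (X t ω)| ∂P ≤ 2 * (B * |x - y|) := by
  have i1 : Integrable (fun ω => |ind x (X t ω) - ind y (X t ω)|) P :=
    ((c.ind_int x t).sub (c.ind_int y t)).abs
  have h : ∫ ω, |ctr F x (X t ω) - ctr F y (X t ω)| ∂P
      ≤ ∫ ω, (|ind x (X t ω) - ind y (X t ω)| + |F x - F y|) ∂P := by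
    refine integral_mono ((c.ctr_int x t).sub (c.ctr_int y t)).abs (i1.add (integrable_const _)) fun ω => ?_
    show |ind x (X t ω) - F x - (ind y (X t ω) - F y)| ≤ |ind x (X t ω) - ind y (X t ω)| + |F x - F y|
    rw [show ind x (X t ω) - F x - (ind y (X t ω) - F y)
      = (ind x (X t ω) - ind y (X t ω)) - (F x - F y) by ring]
    exact abs_sub _ _
  rw [integral_add i1 (integrable_const _), c.ind_diff] at h
  have := c.lip y x
  simp at h
  linarith

lemma Ctx.diff_sq (c : Ctx P X Y ψ F B C) (x y : ℝ) (n : ℕ) :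
    ∫ ω, (∑ t ∈ Finset.range n, (ctr F x (X (t + 1) ω) - ctr F y (X (t + 1) ω))) ^ 2 ∂P
      ≤ n * ∑' h : ℤ, min ((4 * 2 ^ 2 * C + 2 ^ 2) / ((|h| : ℤ) + 1 : ℝ) ^ 2) (4 * (B * |x - y|)) := by
  have hN := c.diff_nice x y
  have h0 : ∀ t, ∫ ω, (ctr F x (X t ω) - ctr F y (X t ω)) ∂P = 0 := fun t => by
    rw [integral_sub (c.ctr_int x t) (c.ctr_int y t), ctr_zero c.hmeas c.hstat c.hF,
      ctr_zero c.hmeas c.hstat c.hF, sub_zero]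
  have hB := c.hB
  have hC0 := c.hC0
  have hsm := summable_maj (4 * 2 ^ 2 * C + 2 ^ 2)
  have := sum_sq_le (P := P) (Z := fun t ω => ctr F x (X t ω) - ctr F y (X t ω)) (M := 2)
    (c := fun h : ℤ => min ((4 * 2 ^ 2 * C + 2 ^ 2) / ((|h| : ℤ) + 1 : ℝ) ^ 2) (4 * (B * |x - y|)))
    (fun t => hN.1.comp (c.hmeas t)) (fun t ω => hN.2.1 _)
    (Summable.of_nonneg_of_le (fun h => le_min (by positivity) (by positivity))
      (fun h => min_le_left _ _) hsm)
    (fun s t => le_min (nice_cov c.hmeas c.hY c.hind c.hC0 c.hC hN hN h0 s t) (by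
      have h1 := abs_cov_trivial (P := P) c.hmeas hN.1 hN.1 hN.2.1 hN.2.1 s t
      have h2 := c.diff_l1 x y s
      linarith))
    ((Finset.range n).map ⟨fun t : ℕ => (t : ℤ) + 1, fun a b h => by simpa using h⟩)
  rw [Finset.card_map, Finset.card_range] at this
  simp only [Finset.sum_map] at this
  exact this

lemma Ctx.ctr_sq (c : Ctx P X Y ψ F B C) (x : ℝ) : ∃ R : ℝ, 0 ≤ R ∧ ∀ n : ℕ,
    ∫ ω, (∑ t ∈ Finset.range n, ctr F x (X (t + 1) ω)) ^ 2 ∂P ≤ n * R := by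
  have hN := ctr_nice c.hF c.happ x
  have hC0 := c.hC0
  refine ⟨∑' h : ℤ, (4 * 1 ^ 2 * C + 1 ^ 2) / ((|h| : ℤ) + 1 : ℝ) ^ 2,
    tsum_nonneg fun h => by positivity, fun n => ?_⟩
  have := sum_sq_le (P := P) (Z := fun t ω => ctr F x (X t ω)) (M := 1)
    (fun t => hN.1.comp (c.hmeas t)) (fun t ω => hN.2.1 _) (summable_maj (4 * 1 ^ 2 * C + 1 ^ 2))
    (fun s t => nice_cov c.hmeas c.hY c.hind c.hC0 c.hC hN hN
      (ctr_zero c.hmeas c.hstat c.hF x) s t)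
    ((Finset.range n).map ⟨fun t : ℕ => (t : ℤ) + 1, fun a b h => by simpa using h⟩)
  rw [Finset.card_map, Finset.card_range] at this
  simp only [Finset.sum_map] at this
  exact this

lemma inv_sqrt_tendsto : Tendsto (fun n : ℕ => (Real.sqrt n)⁻¹) atTop (𝓝 0) :=
  tendsto_inv_atTop_zero.comp (Real.tendsto_sqrt_atTop.comp tendsto_natCast_atTop_atTop)

lemma un_tendsto {ξ D : ℝ} (hD : 0 < D) (hd : HasDerivAt F D ξ) (u : ℝ) :
    Tendsto (fun n : ℕ => Real.sqrt n * (F (ξ + u / Real.sqrt n) - F ξ) / D) atTop (𝓝 u) := by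
  have h1 : HasDerivAt (fun s : ℝ => F (ξ + u * s)) (D * u) 0 := by
    have h2 : HasDerivAt (fun s : ℝ => ξ + u * s) u 0 := by
      simpa using ((hasDerivAt_id (0 : ℝ)).const_mul u).const_add ξ
    have h3 : HasDerivAt F D (ξ + u * 0) := by simpa using hd
    exact h3.comp (0 : ℝ) h2
  have h4 := h1.tendsto_slope_zero
  have h5 : Tendsto (fun n : ℕ => (Real.sqrt n)⁻¹) atTop (𝓝[≠] 0) := by
    refine tendsto_nhdsWithin_iff.2 ⟨inv_sqrt_tendsto, ?_⟩
    filter_upwards [eventually_ge_atTop 1] with n hn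
    have : (0 : ℝ) < n := by exact_mod_cast hn
    simp only [Set.mem_compl_iff, Set.mem_singleton_iff]
    positivity
  have h6 := (h4.comp h5).div_const D
  have e : D * u / D = u := by field_simp
  rw [e] at h6
  refine h6.congr fun n => ?_
  simp [div_eq_mul_inv]

/-- linearized quantile -/
noncomputable def Wn (X : ℤ → Ω → ℝ) (F : ℝ → ℝ) (D ξ : ℝ) (n : ℕ) (ω : Ω) : ℝ :=
  -(∑ t ∈ Finset.range n, ctr F ξ (X (t + 1) ω)) / (Real.sqrt n * D)

lemma Ctx.sum_meas (c : Ctx P X Y ψ F B C) (x : ℝ) (n : ℕ) :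
    Measurable fun ω => ∑ t ∈ Finset.range n, ctr F x (X (t + 1) ω) :=
  Finset.measurable_sum _ fun t _ => (ctr_nice c.hF c.happ x).1.comp (c.hmeas _)

lemma Ctx.sum_bdd (c : Ctx P X Y ψ F B C) (x : ℝ) (n : ℕ) (ω : Ω) :
    |∑ t ∈ Finset.range n, ctr F x (X (t + 1) ω)| ≤ n := by
  refine (Finset.abs_sum_le_sum_abs _ _).trans ?_
  have := Finset.sum_le_sum (s := Finset.range n) fun (t : ℕ) _ =>
    (ctr_nice c.hF c.happ x).2.1 (X (t + 1) ω)
  simpa using this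

lemma Ctx.wn_meas (c : Ctx P X Y ψ F B C) (D x : ℝ) (n : ℕ) : Measurable (Wn X F D x n) :=
  (c.sum_meas x n).neg.div_const _

lemma Ctx.bahadur (c : Ctx P X Y ψ F B C) {ξ D p : ℝ} (hD : 0 < D) (hd : HasDerivAt F D ξ)
    (hFξ : F ξ = p) (h0 : 0 < p) (h1 : p < 1) {ε : ℝ} (hε : 0 < ε) :
    Tendsto (fun n : ℕ => P {ω | ε ≤ |Real.sqrt n * (empQuantileZ X n p ω - ξ) - Wn X F D ξ n ω|})
      atTop (𝓝 0) := by
  refine ghosh (W' := fun u n ω => Wn X F D (ξ + u / Real.sqrt n) n ω)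
    (un := fun u n => Real.sqrt n * (F (ξ + u / Real.sqrt n) - F ξ) / D) ?_ (un_tendsto hD hd) ?_ ?_ hε
  · intro u
    filter_upwards [eventually_ge_atTop 1] with n hn ω
    have hn0 : (0 : ℝ) < n := by exact_mod_cast hn
    have hs : 0 < Real.sqrt n := Real.sqrt_pos.2 hn0
    have hsq : Real.sqrt n * Real.sqrt n = n := Real.mul_self_sqrt hn0.le
    have e1 : Real.sqrt n * (empQuantileZ X n p ω - ξ) ≤ u ↔ empQuantileZ X n p ω ≤ ξ + u / Real.sqrt n := by
      rw [mul_comm, ← le_div_iff₀ hs, sub_le_iff_le_add']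
    rw [e1, emp_le_iff hn h0 h1]
    set x := ξ + u / Real.sqrt n
    unfold Wn
    have e2 : ∑ t ∈ Finset.range n, ctr F x (X (t + 1) ω)
        = ∑ t ∈ Finset.range n, ind x (X (t + 1) ω) - n * F x := by
      simp [ctr, Finset.sum_sub_distrib]
    rw [e2, hFξ]
    generalize ∑ t ∈ Finset.range n, ind x (X (t + 1) ω) = S
    rw [div_le_div_iff₀ (by positivity) hD, inv_mul_eq_div, le_div_iff₀ hn0]
    have e3 : Real.sqrt n * (F x - p) * (Real.sqrt n * D) = (n * (F x - p)) * D := by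
      linear_combination ((F x - p) * D) * hsq
    rw [e3, mul_le_mul_iff_left₀ hD]
    constructor <;> intro h <;> linarith
  · intro u e he
    have hle : ∀ᶠ n : ℕ in atTop, P {ω | e ≤ |Wn X F D (ξ + u / Real.sqrt n) n ω - Wn X F D ξ n ω|}
        ≤ ENNReal.ofReal ((∑' h : ℤ, min ((4 * 2 ^ 2 * C + 2 ^ 2) / ((|h| : ℤ) + 1 : ℝ) ^ 2)
          (4 * (B * |u / Real.sqrt n|))) / D ^ 2 / e ^ 2) := by
      filter_upwards [eventually_ge_atTop 1] with n hn
      have hn0 : (0 : ℝ) < n := by exact_mod_cast hn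
      have hs : 0 < Real.sqrt n := Real.sqrt_pos.2 hn0
      have hsq : Real.sqrt n ^ 2 = n := Real.sq_sqrt hn0.le
      set x := ξ + u / Real.sqrt n with hx
      have hW : ∀ ω, Wn X F D x n ω - Wn X F D ξ n ω =
          -(∑ t ∈ Finset.range n, (ctr F x (X (t + 1) ω) - ctr F ξ (X (t + 1) ω))) / (Real.sqrt n * D) := by
        intro ω; unfold Wn; rw [Finset.sum_sub_distrib]; ring
      have hb : ∀ ω, |Wn X F D x n ω - Wn X F D ξ n ω| ≤ (n + n) / (Real.sqrt n * D) := by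
        intro ω
        rw [hW, abs_div, abs_neg, abs_of_pos (by positivity : 0 < Real.sqrt n * D), Finset.sum_sub_distrib]
        gcongr
        exact (abs_sub _ _).trans (add_le_add (c.sum_bdd x n ω) (c.sum_bdd ξ n ω))
      refine (cheb ((c.wn_meas D x n).sub (c.wn_meas D ξ n)) hb he).trans ?_
      apply ENNReal.ofReal_le_ofReal
      gcongr
      show ∫ ω, (Wn X F D x n ω - Wn X F D ξ n ω) ^ 2 ∂P ≤ _
      simp_rw [hW, div_pow, neg_sq]
      rw [integral_div, mul_pow, hsq, div_le_div_iff₀ (by positivity) (by positivity)]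
      have := c.diff_sq x ξ n
      rw [show x - ξ = u / Real.sqrt n by rw [hx]; ring] at this
      have hD2 : 0 < D ^ 2 := by positivity
      nlinarith
    have hB := c.hB
    have hC0 := c.hC0
    have ht : Tendsto (fun n : ℕ => 4 * (B * |u / Real.sqrt n|)) atTop (𝓝 0) := by
      have := (((inv_sqrt_tendsto.const_mul u).abs).const_mul B).const_mul 4
      simpa [div_eq_mul_inv] using this
    have h2 := tsum_min_tendsto (c := fun h : ℤ => (4 * 2 ^ 2 * C + 2 ^ 2) / ((|h| : ℤ) + 1 : ℝ) ^ 2)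
      (fun h => by positivity) (summable_maj _) (fun n => by positivity) ht
    have h3 := ENNReal.tendsto_ofReal ((h2.div_const (D ^ 2)).div_const (e ^ 2))
    simp only [zero_div, ENNReal.ofReal_zero] at h3
    exact tendsto_of_tendsto_of_tendsto_of_le_of_le' tendsto_const_nhds h3
      (Eventually.of_forall fun _ => zero_le) hle
  · intro η hη
    obtain ⟨R, hR0, hR⟩ := c.ctr_sq ξ
    have hle : ∀ L : ℝ, 0 < L → ∀ᶠ n : ℕ in atTop, P {ω | L ≤ |Wn X F D ξ n ω|}
        ≤ ENNReal.ofReal (R / D ^ 2 / L ^ 2) := by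
      intro L hL
      filter_upwards [eventually_ge_atTop 1] with n hn
      have hn0 : (0 : ℝ) < n := by exact_mod_cast hn
      have hs : 0 < Real.sqrt n := Real.sqrt_pos.2 hn0
      have hsq : Real.sqrt n ^ 2 = n := Real.sq_sqrt hn0.le
      have hb : ∀ ω, |Wn X F D ξ n ω| ≤ n / (Real.sqrt n * D) := by
        intro ω
        unfold Wn
        rw [abs_div, abs_neg, abs_of_pos (by positivity : 0 < Real.sqrt n * D)]
        gcongr
        exact c.sum_bdd ξ n ω
      refine (cheb (c.wn_meas D ξ n) hb hL).trans ?_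
      apply ENNReal.ofReal_le_ofReal
      gcongr
      unfold Wn
      simp_rw [div_pow, neg_sq]
      rw [integral_div, mul_pow, hsq, div_le_div_iff₀ (by positivity) (by positivity)]
      have := hR n
      have hD2 : 0 < D ^ 2 := by positivity
      nlinarith
    have hlim : Tendsto (fun L : ℝ => ENNReal.ofReal (R / D ^ 2 / L ^ 2)) atTop (𝓝 0) := by
      have h2 : Tendsto (fun L : ℝ => R / D ^ 2 / L ^ 2) atTop (𝓝 0) :=
        tendsto_const_nhds.div_atTop (tendsto_pow_atTop (by norm_num))
      simpa using ENNReal.tendsto_ofReal h2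
    obtain ⟨L, hL1, hL2⟩ := ((ENNReal.tendsto_nhds_zero.1 hlim η hη).and (eventually_gt_atTop 0)).exists
    exact ⟨L, (hle L hL2).mono fun n hn => hn.trans hL1⟩

end bahadur2


section cw
set_option linter.unusedSectionVars false
variable {Ω : Type*} [MeasurableSpace Ω] {P : Measure Ω} [IsProbabilityMeasure P]

lemma cw_quad {k : ℕ} (S : Matrix (Fin k) (Fin k) ℝ) (a : Fin k → ℝ) :
    a ⬝ᵥ S.mulVec a = ∑ i, ∑ j, a i * a j * S i j := by
  simp only [dotProduct, Matrix.mulVec, Finset.mul_sum]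
  refine Finset.sum_congr rfl fun i _ => Finset.sum_congr rfl fun j _ => by ring

lemma cw_inner {k : ℕ} (x a : EuclideanSpace ℝ (Fin k)) : inner ℝ x a = ∑ i, a i * x i := by
  simp [PiLp.inner_apply]

lemma cw_dist {k : ℕ} {S : Matrix (Fin k) (Fin k) ℝ} (hS : S.PosSemidef)
    {W : ℕ → Ω → Fin k → ℝ} (hW : ∀ n, Measurable (W n))
    (h : ∀ a : Fin k → ℝ, Tendsto (fun n => cfn P (fun ω => ∑ i, a i * W n ω i) 1) atTop
      (𝓝 ((Real.exp (-(1 / 2 * ∑ i, ∑ j, a i * a j * S i j)) : ℝ) : ℂ))) :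
    TendstoInDistribution (fun n ω => WithLp.toLp 2 (W n ω)) atTop (id : EuclideanSpace ℝ (Fin k) → _)
      (fun _ => P) (multivariateGaussian 0 S) where
  forall_aemeasurable n := by
    have := hW n
    exact ((PiLp.continuous_toLp 2 _).measurable.comp this).aemeasurable
  aemeasurable_limit := aemeasurable_id
  tendsto := by
    refine ProbabilityMeasure.tendsto_iff_tendsto_charFun.2 fun a ↦ ?_
    have e : charFun ((multivariateGaussian 0 S).map id) a =
        ((Real.exp (-(1 / 2 * ∑ i, ∑ j, a i * a j * S i j)) : ℝ) : ℂ) := by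
      rw [Measure.map_id, charFun_multivariateGaussian hS, cw_quad]
      simp
      congr 1
      ring
    refine Tendsto.congr (fun n => ?_) (e ▸ h a)
    have hm : Measurable (fun ω => (WithLp.toLp 2 (W n ω) : EuclideanSpace ℝ (Fin k))) :=
      (PiLp.continuous_toLp 2 _).measurable.comp (hW n)
    show _ = charFun (P.map _) a
    rw [charFun_apply, integral_map hm.aemeasurable (by fun_prop)]
    unfold cfn
    congr 1; ext ω
    rw [cw_inner, one_mul]

lemma cw_main {k : ℕ} {S : Matrix (Fin k) (Fin k) ℝ} (hS : S.PosSemidef)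
    {W V : ℕ → Ω → Fin k → ℝ} (hW : ∀ n, Measurable (W n)) (hV : ∀ n, Measurable (V n))
    (h : ∀ a : Fin k → ℝ, Tendsto (fun n => cfn P (fun ω => ∑ i, a i * W n ω i) 1) atTop
      (𝓝 ((Real.exp (-(1 / 2 * ∑ i, ∑ j, a i * a j * S i j)) : ℝ) : ℂ)))
    (hd : ∀ i, ∀ ε > 0, Tendsto (fun n => P {ω | ε ≤ |V n ω i - W n ω i|}) atTop (𝓝 0)) :
    ∃ μ : Measure (Fin k → ℝ), IsProbabilityMeasure μ ∧
      (∀ g : BoundedContinuousFunction (Fin k → ℝ) ℝ,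
        Tendsto (fun n : ℕ => ∫ ω, g (V n ω) ∂P) atTop (𝓝 (∫ x, g x ∂μ))) ∧
      (∀ a : Fin k → ℝ, μ.map (fun x => ∑ i, a i * x i) =
          gaussianReal 0 (Real.toNNReal (∑ i, ∑ j, a i * a j * S i j))) := by
  have h1 := (cw_dist hS hW h).continuous_comp (PiLp.continuous_ofLp 2 (fun _ : Fin k => ℝ))
  have hm : Measurable (WithLp.ofLp : EuclideanSpace ℝ (Fin k) → Fin k → ℝ) :=
    (PiLp.continuous_ofLp 2 _).measurable
  have h2 : TendstoInDistribution V atTop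
      (WithLp.ofLp ∘ (id : EuclideanSpace ℝ (Fin k) → EuclideanSpace ℝ (Fin k)))
      (fun _ => P) (multivariateGaussian 0 S) := by
    refine tendstoInDistribution_of_tendstoInMeasure_sub V _ h1 ?_ fun n => (hV n).aemeasurable
    rw [tendstoInMeasure_iff_norm]
    intro ε hε
    have hsum : Tendsto (fun n => ∑ i, P {ω | ε ≤ |V n ω i - W n ω i|}) atTop (𝓝 0) := by
      have := tendsto_finsetSum Finset.univ (fun i (_ : i ∈ Finset.univ) => hd i ε hε)
      simpa using this
    refine tendsto_of_tendsto_of_tendsto_of_le_of_le tendsto_const_nhds hsum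
      (fun _ => zero_le) (fun n => ?_)
    refine (measure_mono ?_).trans (measure_iUnion_fintype_le P _)
    intro ω hω
    by_contra hc
    simp only [Set.mem_iUnion, Set.mem_ofPred_eq, not_exists, not_le] at hc hω
    refine absurd hω (not_le.2 ?_)
    rw [pi_norm_lt_iff hε]
    intro i
    simpa [Real.norm_eq_abs] using hc i
  refine ⟨(multivariateGaussian 0 S).map WithLp.ofLp,
    Measure.isProbabilityMeasure_map hm.aemeasurable, fun g => ?_, fun a => ?_⟩
  · have h3 := (ProbabilityMeasure.tendsto_iff_forall_integral_tendsto.1 h2.tendsto) g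
    refine Tendsto.congr (fun n => ?_) h3
    exact integral_map (hV n).aemeasurable (by fun_prop)
  · have hq : 0 ≤ ∑ i, ∑ j, a i * a j * S i j := by
      rw [← cw_quad]
      simpa using hS.dotProduct_mulVec_nonneg a
    have hl : Measurable (fun x : Fin k → ℝ => ∑ i, a i * x i) := by fun_prop
    have : IsProbabilityMeasure ((multivariateGaussian 0 S).map
      (WithLp.ofLp : EuclideanSpace ℝ (Fin k) → Fin k → ℝ)) :=
      Measure.isProbabilityMeasure_map hm.aemeasurable
    have := Measure.isProbabilityMeasure_map (μ := (multivariateGaussian 0 S).map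
      (WithLp.ofLp : EuclideanSpace ℝ (Fin k) → Fin k → ℝ)) hl.aemeasurable
    apply Measure.ext_of_charFun
    ext t
    rw [charFun_gaussianReal, Measure.map_map hl hm, charFun_apply_real,
      integral_map (hl.comp hm).aemeasurable (by fun_prop)]
    have := charFun_multivariateGaussian (μ := 0) hS (WithLp.toLp 2 (fun i => t * a i))
    rw [charFun_apply, cw_quad] at this
    simp_rw [cw_inner] at this
    have e1 : ∀ x : EuclideanSpace ℝ (Fin k), (t : ℂ) * (((fun x : Fin k → ℝ => ∑ i, a i * x i) ∘ WithLp.ofLp) x : ℝ)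
        = ((∑ i, (t * a i) * x i : ℝ) : ℂ) := by
      intro x
      simp [Finset.mul_sum, mul_assoc]
    simp_rw [e1]
    rw [this, Real.coe_toNNReal _ hq]
    congr 1
    have e2 : ∑ i, ∑ j, t * a i * (t * a j) * S i j = t ^ 2 * ∑ i, ∑ j, a i * a j * S i j := by
      simp_rw [Finset.mul_sum]
      refine Finset.sum_congr rfl fun i _ => Finset.sum_congr rfl fun j _ => by ring
    rw [e2]
    simp
    ring

end cw


section covs
set_option linter.unusedSectionVars false
variable {Ω : Type*} [MeasurableSpace Ω] {P : Measure Ω} [IsProbabilityMeasure P]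
variable {X : ℤ → Ω → ℝ} {Y : ℤ → ℕ → Ω → ℝ} {ψ : ℕ → ℝ} {F : ℝ → ℝ} {B C : ℝ}

/-- lagged covariance of indicators -/
noncomputable def cc (P : Measure Ω) (X : ℤ → Ω → ℝ) (F : ℝ → ℝ) (x y : ℝ) (h : ℤ) : ℝ :=
  ∫ ω, ctr F x (X 0 ω) * ctr F y (X h ω) ∂P

lemma Ctx.cc_summable (c : Ctx P X Y ψ F B C) (x y : ℝ) : Summable (cc P X F x y) := by
  refine Summable.of_norm_bounded (summable_maj (4 * 1 ^ 2 * C + 1 ^ 2)) fun h => ?_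
  have := nice_cov c.hmeas c.hY c.hind c.hC0 c.hC (ctr_nice c.hF c.happ x) (ctr_nice c.hF c.happ y)
      (ctr_zero c.hmeas c.hstat c.hF x) 0 h
  simpa [cc] using this

lemma Ctx.cc_eq (c : Ctx P X Y ψ F B C) (x y : ℝ) (h : ℤ) :
    (P {ω | X 0 ω ≤ x ∧ X h ω ≤ y}).toReal - F x * F y = cc P X F x y h := by
  have hms : MeasurableSet {ω | X 0 ω ≤ x ∧ X h ω ≤ y} :=
    (measurableSet_le (c.hmeas 0) measurable_const).inter (measurableSet_le (c.hmeas h) measurable_const)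
  have e : ∀ ω, ctr F x (X 0 ω) * ctr F y (X h ω) =
      Set.indicator {ω | X 0 ω ≤ x ∧ X h ω ≤ y} (fun _ => (1 : ℝ)) ω - F y * ind x (X 0 ω)
        - F x * ctr F y (X h ω) := by
    intro ω
    have : Set.indicator {ω | X 0 ω ≤ x ∧ X h ω ≤ y} (fun _ => (1 : ℝ)) ω
        = ind x (X 0 ω) * ind y (X h ω) := by
      simp only [Set.indicator, ind, Set.mem_ofPred_eq]
      by_cases h1 : X 0 ω ≤ x <;> by_cases h2 : X h ω ≤ y <;> simp [h1, h2]
    rw [this]; unfold ctr; ring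
  have i0 : Integrable (fun ω => Set.indicator {ω | X 0 ω ≤ x ∧ X h ω ≤ y} (fun _ => (1 : ℝ)) ω - F y * ind x (X 0 ω)) P :=
    ((integrable_const _).indicator hms).sub ((c.ind_int x 0).const_mul _)
  have i1 : Integrable (Set.indicator {ω | X 0 ω ≤ x ∧ X h ω ≤ y} (fun _ => (1 : ℝ))) P :=
    (integrable_const _).indicator hms
  unfold cc
  simp_rw [e]
  rw [integral_sub i0 ((c.ctr_int y h).const_mul _),
    integral_sub i1 ((c.ind_int x 0).const_mul _), integral_const_mul, integral_const_mul,
    ctr_zero c.hmeas c.hstat c.hF, ind_integral c.hmeas c.hstat c.hF, integral_indicator hms]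
  simp [Measure.real]
  ring

lemma Ctx.cc_symm (c : Ctx P X Y ψ F B C) (x y : ℝ) : ∑' h, cc P X F x y h = ∑' h, cc P X F y x h := by
  rw [← (Equiv.neg ℤ).tsum_eq]
  refine tsum_congr fun h => ?_
  unfold cc
  simp only [Equiv.neg_apply]
  have h2 := stat_two c.hmeas c.hstat (ctr_nice c.hF c.happ x).1 (ctr_nice c.hF c.happ y).1 h 0
  simp only [zero_sub] at h2
  rw [← h2]
  simp_rw [mul_comm (ctr F x _)]

/-- linear combination -/
noncomputable def lc {k : ℕ} (F : ℝ → ℝ) (ξ b : Fin k → ℝ) (z : ℝ) : ℝ := ∑ i, b i * ctr F (ξ i) z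

lemma Ctx.lc_nice {k : ℕ} (c : Ctx P X Y ψ F B C) (ξ b : Fin k → ℝ) :
    NiceFn P X Y ψ (∑ i, |b i| * 1) (lc F ξ b) :=
  NiceFn.sum c.hmeas c.hY (fun i => ctr_nice c.hF c.happ (ξ i)) b Finset.univ

lemma Ctx.lc_zero {k : ℕ} (c : Ctx P X Y ψ F B C) (ξ b : Fin k → ℝ) (t : ℤ) :
    ∫ ω, lc F ξ b (X t ω) ∂P = 0 := by
  unfold lc
  rw [integral_finsetSum _ fun i _ => (c.ctr_int (ξ i) t).const_mul _]
  simp [integral_const_mul, ctr_zero c.hmeas c.hstat c.hF]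

lemma Ctx.lc_cov {k : ℕ} (c : Ctx P X Y ψ F B C) (ξ b : Fin k → ℝ) (h : ℤ) :
    ∫ ω, lc F ξ b (X 0 ω) * lc F ξ b (X h ω) ∂P = ∑ i, ∑ j, b i * b j * cc P X F (ξ i) (ξ j) h := by
  have e : ∀ ω, lc F ξ b (X 0 ω) * lc F ξ b (X h ω) =
      ∑ i, ∑ j, b i * b j * (ctr F (ξ i) (X 0 ω) * ctr F (ξ j) (X h ω)) := by
    intro ω
    unfold lc
    rw [Finset.sum_mul_sum]
    refine Finset.sum_congr rfl fun i _ => Finset.sum_congr rfl fun j _ => by ring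
  have hi : ∀ i j, Integrable (fun ω => b i * b j * (ctr F (ξ i) (X 0 ω) * ctr F (ξ j) (X h ω))) P := by
    intro i j
    refine Integrable.const_mul ?_ _
    have h1 := ctr_nice c.hF c.happ (ξ i)
    have h2 := ctr_nice c.hF c.happ (ξ j)
    refine bdd_integrable ((h1.1.comp (c.hmeas 0)).mul (h2.1.comp (c.hmeas h))) (C := 1 * 1) fun ω => ?_
    refine (abs_mul _ _).trans_le ?_
    exact mul_le_mul (h1.2.1 _) (h2.2.1 _) (abs_nonneg _) zero_le_one
  simp_rw [e]
  rw [integral_finsetSum _ fun i _ => integrable_finsetSum _ fun j _ => hi i j]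
  refine Finset.sum_congr rfl fun i _ => ?_
  rw [integral_finsetSum _ fun j _ => hi i j]
  refine Finset.sum_congr rfl fun j _ => ?_
  rw [integral_const_mul]; rfl

lemma Ctx.lc_hasSum {k : ℕ} (c : Ctx P X Y ψ F B C) (ξ b : Fin k → ℝ) :
    HasSum (fun h : ℤ => ∫ ω, lc F ξ b (X 0 ω) * lc F ξ b (X h ω) ∂P)
      (∑ i, ∑ j, b i * b j * ∑' h, cc P X F (ξ i) (ξ j) h) := by
  simp_rw [c.lc_cov]
  exact hasSum_sum fun i _ => hasSum_sum fun j _ => (c.cc_summable (ξ i) (ξ j)).hasSum.mul_left _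

lemma Ctx.lc_nonneg {k : ℕ} (c : Ctx P X Y ψ F B C) (ξ b : Fin k → ℝ) :
    0 ≤ ∑ i, ∑ j, b i * b j * ∑' h, cc P X F (ξ i) (ξ j) h := by
  rw [← (c.lc_hasSum ξ b).tsum_eq]
  refine ge_of_tendsto' (var_limit c.hmeas c.hstat (c.lc_nice ξ b).1 (c.lc_nice ξ b).2.1
    (c.lc_hasSum ξ b).summable) fun n => ?_
  exact div_nonneg (integral_nonneg fun ω => sq_nonneg _) (Nat.cast_nonneg _)

/-- limiting covariance -/
noncomputable def SM {k : ℕ} (P : Measure Ω) (X : ℤ → Ω → ℝ) (F : ℝ → ℝ) (ξ D : Fin k → ℝ) :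
    Matrix (Fin k) (Fin k) ℝ := fun i j => (∑' h, cc P X F (ξ i) (ξ j) h) / (D i * D j)

lemma SM_quad {k : ℕ} (ξ D a : Fin k → ℝ) :
    ∑ i, ∑ j, a i * a j * SM P X F ξ D i j
      = ∑ i, ∑ j, (-(a i / D i)) * (-(a j / D j)) * ∑' h, cc P X F (ξ i) (ξ j) h := by
  refine Finset.sum_congr rfl fun i _ => Finset.sum_congr rfl fun j _ => ?_
  unfold SM
  rw [div_eq_mul_inv _ (D i * D j), mul_inv]; ring

lemma Ctx.SM_psd {k : ℕ} (c : Ctx P X Y ψ F B C) (ξ D : Fin k → ℝ) : (SM P X F ξ D).PosSemidef := by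
  refine Matrix.PosSemidef.of_dotProduct_mulVec_nonneg ?_ fun a => ?_
  · ext i j
    simp only [Matrix.conjTranspose_apply, SM, star_trivial]
    rw [c.cc_symm, mul_comm]
  · rw [star_trivial, cw_quad, SM_quad]
    exact c.lc_nonneg ξ _

lemma Ctx.wn_cfn {k : ℕ} (c : Ctx P X Y ψ F B C) (ξ D a : Fin k → ℝ) :
    Tendsto (fun n : ℕ => cfn P (fun ω => ∑ i, a i * Wn X F (D i) (ξ i) n ω) 1) atTop
      (𝓝 ((Real.exp (-(1 / 2 * ∑ i, ∑ j, a i * a j * SM P X F ξ D i j)) : ℝ) : ℂ)) := by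
  have h := clt_cfn c.hmeas c.hstat c.hY c.hind c.hψ0 c.hψ (c.lc_nice ξ (fun i => -(a i / D i)))
    (c.lc_zero ξ _) 1
  rw [(c.lc_hasSum ξ _).tsum_eq, ← SM_quad] at h
  rw [one_pow] at h
  refine h.congr fun n => ?_
  unfold cfn
  congr 1; ext ω
  congr 3
  unfold lc Wn
  beta_reduce
  rw [Finset.sum_comm, Finset.mul_sum, one_mul]
  refine Finset.sum_congr rfl fun i _ => ?_
  rw [← Finset.mul_sum, div_eq_mul_inv _ (Real.sqrt n * D i), mul_inv]
  ring

end covs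


/-- Asymptotic normality of empirical quantiles of an S-mixing process
(Dehling–Heinrich–Overgaard–Vogel, Theorem 1).  The entries of the limiting
covariance matrix are `σ_{ij} = Σ_{h ∈ ℤ} (P(X₀ ≤ ξᵢ, X_h ≤ ξⱼ) − pᵢ pⱼ) / (f(ξᵢ) f(ξⱼ))`,
the series being summable; the centered `k`-dimensional Gaussian limit is characterized
by the Cramér–Wold property. -/
theorem empQuantiles_smixing_asymptotic_normality
    {Ω : Type*} [MeasurableSpace Ω] (P : Measure Ω) [IsProbabilityMeasure P]
    (X : ℤ → Ω → ℝ) (hmeas : ∀ t, Measurable (X t))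
    (hstat : StrictlyStationary P X)
    (γ δ : ℕ → ℝ) (hmix : SMixing P X γ δ)
    (A : ℝ) (hA : 4 < A)
    (Cγ : ℝ) (hγ : ∀ m : ℕ, 1 ≤ m → |γ m| ≤ Cγ * (m : ℝ) ^ (-A))
    (Cδ : ℝ) (hδ : ∀ m : ℕ, 1 ≤ m → |δ m| ≤ Cδ * (m : ℝ) ^ (-A))
    (F f : ℝ → ℝ) (hF : ∀ x, F x = (P {ω | X 0 ω ≤ x}).toReal)
    (k : ℕ) (p : Fin k → ℝ) (hp0 : ∀ i, 0 < p i) (hp1 : ∀ i, p i < 1)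
    (hpmono : StrictMono p)
    (ξ : Fin k → ℝ) (hξ : ∀ i, ξ i = quantileOf F (p i))
    (hdens : ∀ x, F x = ∫ s in Set.Iic x, f s)
    (hfpos : ∀ i, ∃ U ∈ 𝓝 (ξ i), ∀ x ∈ U, 0 < f x ∧ ContinuousAt f x)
    (B : ℝ) (hfB : ∀ x, f x ≤ B) :
    (∀ i j : Fin k,
      Summable (fun h : ℤ =>
        (P {ω | X 0 ω ≤ ξ i ∧ X h ω ≤ ξ j}).toReal - p i * p j)) ∧
    ∃ μ : Measure (Fin k → ℝ), IsProbabilityMeasure μ ∧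
      (∀ g : BoundedContinuousFunction (Fin k → ℝ) ℝ,
        Tendsto
          (fun n : ℕ =>
            ∫ ω, g (fun i => Real.sqrt n * (empQuantileZ X n (p i) ω - ξ i)) ∂P)
          atTop (𝓝 (∫ x, g x ∂μ))) ∧
      (∀ a : Fin k → ℝ,
        μ.map (fun x => ∑ i, a i * x i) =
          gaussianReal 0 (Real.toNNReal (∑ i, ∑ j, a i * a j *
            ((∑' h : ℤ, ((P {ω | X 0 ω ≤ ξ i ∧ X h ω ≤ ξ j}).toReal - p i * p j)) /
              (f (ξ i) * f (ξ j)))))) := by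
  have hdf := F_df hmeas hF
  obtain ⟨Y, ψ, hY, hind, hψ0, hψ, happ⟩ :=
    ind_approx hmeas hstat hmix hA hγ hδ hF hdens hfB
  obtain ⟨C, hC0, hC⟩ := psi_bound hψ
  have c : Ctx P X Y ψ F B C := ⟨hmeas, hstat, hY, hind, hψ0, hψ, hC0, hC, hF, happ, hdf.mono,
    B_nonneg hdf hdens hfB, F_lip_abs hdf hdens hfB⟩
  have hFξ : ∀ i, F (ξ i) = p i := fun i => by
    rw [hξ]; exact F_quant hdf (F_cont hdf hdens hfB) (hp0 i) (hp1 i)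
  have hfi : ∀ i, 0 < f (ξ i) ∧ ContinuousAt f (ξ i) := fun i => by
    obtain ⟨U, hU, h⟩ := hfpos i
    exact h _ (mem_of_mem_nhds hU)
  have hcc : ∀ i j, (fun h : ℤ => (P {ω | X 0 ω ≤ ξ i ∧ X h ω ≤ ξ j}).toReal - p i * p j)
      = cc P X F (ξ i) (ξ j) := fun i j => by
    ext h
    rw [← hFξ, ← hFξ]; exact c.cc_eq _ _ _
  refine ⟨fun i j => by rw [hcc]; exact c.cc_summable _ _, ?_⟩
  have key := cw_main (P := P) (c.SM_psd ξ (fun i => f (ξ i)))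
    (W := fun n ω i => Wn X F (f (ξ i)) (ξ i) n ω)
    (V := fun n ω i => Real.sqrt n * (empQuantileZ X n (p i) ω - ξ i))
    (fun n => measurable_pi_lambda _ fun i => c.wn_meas _ _ n)
    (fun n => measurable_pi_lambda _ fun i =>
      ((emp_meas hmeas n (hp0 i) (hp1 i)).sub_const _).const_mul _)
    (fun a => c.wn_cfn ξ _ a)
    (fun i ε hε => c.bahadur (hfi i).1 (F_deriv hdf hdens (hfi i).2) (hFξ i) (hp0 i) (hp1 i) hε)
  obtain ⟨μ, h1, h2, h3⟩ := key
  refine ⟨μ, h1, h2, fun a => ?_⟩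
  rw [h3 a]
  simp_rw [hcc]
  rfl
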